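/- arXiv:1403.1527 — 2 statements merged into one kernel-verified Lean document; each statement's English description precedes it below -/
import Mathlib

section
/- Let α ⊨ n and let E be an equivalence class of SRCT(α) under ∼_α, with unique source tableau τ_{0,E} and unique sink tableau τ_{1,E}. Then the poset (E, ⪯_α) is a graded lattice, and the map τ ↦ col_τ is a poset isomorphism from (E, ⪯_α) onto the interval [col_{τ_{0,E}}, col_{τ_{1,E}}] of the symmetric group S_n under the left weak Bruhat order ≤_L. -/
/-- Cell `(r,c)` (0-indexed: row `r` from the top, column `c` from the left) of the
reverse composition diagram of the composition `α`. -/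
def IsCell (α : List ℕ) (r c : ℕ) : Prop := r < α.length ∧ c < α.getD r 0

instance (α : List ℕ) (r c : ℕ) : Decidable (IsCell α r c) :=
  inferInstanceAs (Decidable (r < α.length ∧ c < α.getD r 0))

/-- A standard reverse composition tableau (SRCT) of shape `α`: a bijective filling of the
reverse composition diagram of `α` by `{1,…,α.sum}` (with the junk value `0` off the diagram)
whose rows decrease from left to right, whose first column increases from top to bottom,
and which satisfies the triple rule. -/
structure SRCT (α : List ℕ) where
  entry : ℕ → ℕ → ℕ
  zero_off : ∀ r c, ¬ IsCell α r c → entry r c = 0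
  one_le : ∀ r c, IsCell α r c → 1 ≤ entry r c
  le_sum : ∀ r c, IsCell α r c → entry r c ≤ α.sum
  inj : ∀ r c r' c', IsCell α r c → IsCell α r' c' → entry r c = entry r' c' → r = r' ∧ c = c'
  surj : ∀ m, 1 ≤ m → m ≤ α.sum → ∃ r c, IsCell α r c ∧ entry r c = m
  row_dec : ∀ r c, IsCell α r (c + 1) → entry r (c + 1) < entry r c
  col1_inc : ∀ r r', r < r' → IsCell α r 0 → IsCell α r' 0 → entry r 0 < entry r' 0
  triple : ∀ r r' c, r < r' → IsCell α r c → IsCell α r' (c + 1) →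
    entry r' (c + 1) < entry r c → IsCell α r (c + 1) ∧ entry r' (c + 1) < entry r (c + 1)

/-- `i` is a descent of `T`: `i+1` appears weakly right of `i`. -/
def Descent (α : List ℕ) (T : SRCT α) (i : ℕ) : Prop :=
  ∃ r c r' c', IsCell α r c ∧ IsCell α r' c' ∧
    T.entry r c = i ∧ T.entry r' c' = i + 1 ∧ c ≤ c'

/-- `i` and `i+1` are attacking in `T`: same column, or adjacent columns with `i+1`
strictly southeast of `i`. -/
def Attacking (α : List ℕ) (T : SRCT α) (i : ℕ) : Prop :=
  ∃ r c r' c', IsCell α r c ∧ IsCell α r' c' ∧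
    T.entry r c = i ∧ T.entry r' c' = i + 1 ∧ (c' = c ∨ (c' = c + 1 ∧ r < r'))

/-- The entry function of the filling `s_i(T)` obtained from `T` by interchanging the
positions of the entries `i` and `i+1`. -/
def swapEntry (α : List ℕ) (T : SRCT α) (i : ℕ) : ℕ → ℕ → ℕ := fun r c =>
  if T.entry r c = i then i + 1 else if T.entry r c = i + 1 then i else T.entry r c

def maxPart (α : List ℕ) : ℕ := α.foldr max 0

/-- The entries of column `c` of `T`, read from top to bottom. -/
def colList (α : List ℕ) (T : SRCT α) (c : ℕ) : List ℕ :=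
  (List.range α.length).filterMap fun r => if IsCell α r c then some (T.entry r c) else none

/-- The column word of `T`: entries of each column read top to bottom, columns left to right,
viewed as a permutation of `{1,…,n}` in one-line notation. -/
def colWord (α : List ℕ) (T : SRCT α) : List ℕ :=
  (List.range (maxPart α)).flatMap fun c => colList α T c

/-- The inversion set of a one-line word: pairs of positions `p < q` with `w_p > w_q`. -/
def invFinset (w : List ℕ) : Finset (ℕ × ℕ) :=
  (Finset.range w.length ×ˢ Finset.range w.length).filter fun pq =>
    pq.1 < pq.2 ∧ w.getD pq.2 0 < w.getD pq.1 0

/-- The number of inversions, i.e. the Coxeter length of the one-line word. -/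
def invCount (w : List ℕ) : ℕ := (invFinset w).card

/-- The standardization of a word with distinct letters, with ranks `1,…,len`. -/
def stdWord (w : List ℕ) : List ℕ :=
  w.map fun x => (w.filter fun y => decide (y ≤ x)).length

/-- The standardized column word of `T`: concatenation over columns (left to right) of the
standardizations of the column reading words (top to bottom). -/
def stWord (α : List ℕ) (T : SRCT α) : List ℕ :=
  (List.range (maxPart α)).flatMap fun c => stdWord (colList α T c)

/-- The equivalence class of `T0` under `∼_α` (equal standardized column words). -/
def stClass (α : List ℕ) (T0 : SRCT α) : Set (SRCT α) := {T | stWord α T = stWord α T0}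

/-- `T` is a source tableau: for every non-descent `i ≠ n`, the entry `i+1` lies in the cell
immediately to the left of the cell containing `i`. -/
def IsSource (α : List ℕ) (T : SRCT α) : Prop :=
  ∀ i, 1 ≤ i → i < α.sum → ¬ Descent α T i →
    ∃ r c, IsCell α r (c + 1) ∧ T.entry r c = i + 1 ∧ T.entry r (c + 1) = i

/-- `T` is a sink tableau: every descent of `T` is an attacking descent. -/
def IsSink (α : List ℕ) (T : SRCT α) : Prop := ∀ i, Descent α T i → Attacking α T i

/-- One flip: `T' = π_i T` for a non-attacking descent `i`. -/
def SRCTstep (α : List ℕ) (T T' : SRCT α) : Prop :=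
  ∃ i, Descent α T i ∧ ¬ Attacking α T i ∧ T'.entry = swapEntry α T i

/-- The partial order `⪯_α` on `SRCT α`: `T ⪯_α T'` iff `T'` is obtained from `T` by a
(possibly empty) sequence of flips `π_i`. -/
def SRCTle (α : List ℕ) : SRCT α → SRCT α → Prop := Relation.ReflTransGen (SRCTstep α)

namespace WB

/-- Cell `x = (row, column)`. -/
abbrev C (α : List ℕ) (x : ℕ × ℕ) : Prop := IsCell α x.1 x.2

/-- Entry at a cell. -/
abbrev V {α : List ℕ} (T : SRCT α) (x : ℕ × ℕ) : ℕ := T.entry x.1 x.2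

/-- `x` precedes `y` in the column reading order. -/
def Bef (x y : ℕ × ℕ) : Prop := x.2 < y.2 ∨ (x.2 = y.2 ∧ x.1 < y.1)

/-- Cells of one column, top to bottom. -/
def colCells (α : List ℕ) (c : ℕ) : List (ℕ × ℕ) :=
  (List.range α.length).filterMap fun r => if IsCell α r c then some (r, c) else none

/-- All cells in column reading order. -/
def cells (α : List ℕ) : List (ℕ × ℕ) :=
  (List.range (maxPart α)).flatMap fun c => colCells α c

def InvLe (α : List ℕ) (f g : ℕ × ℕ → ℕ) : Prop :=
  ∀ x y, C α x → C α y → Bef x y → f y < f x → g y < g x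

def ColEq (α : List ℕ) (f g : ℕ × ℕ → ℕ) : Prop :=
  ∀ x y, C α x → C α y → x.2 = y.2 → (f x < f y ↔ g x < g y)

lemma le_maxPart (α : List ℕ) (a : ℕ) (h : a ∈ α) : a ≤ maxPart α := by
  induction α with
  | nil => simp at h
  | cons b l ih =>
    simp only [maxPart, List.foldr_cons] at *
    rcases List.mem_cons.1 h with h | h
    · subst h; exact le_max_left _ _
    · exact (ih h).trans (le_max_right _ _)

lemma mem_colCells (α : List ℕ) (c : ℕ) (x : ℕ × ℕ) : x ∈ colCells α c ↔ C α x ∧ x.2 = c := by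
  simp only [colCells, List.mem_filterMap, List.mem_range]
  constructor
  · rintro ⟨r, hr, h⟩
    split_ifs at h with h1
    simp only [Option.some.injEq] at h
    subst h; exact ⟨h1, rfl⟩
  · rintro ⟨h, rfl⟩
    exact ⟨x.1, h.1, by rw [if_pos h]⟩

lemma mem_cells (α : List ℕ) (x : ℕ × ℕ) : x ∈ cells α ↔ C α x := by
  simp only [cells, List.mem_flatMap, mem_colCells, List.mem_range]
  constructor
  · rintro ⟨c, _, h, _⟩; exact h
  · intro h
    refine ⟨x.2, ?_, h, rfl⟩
    have h1 := h.2
    rw [List.getD_eq_getElem _ _ h.1] at h1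
    exact h1.trans_le (le_maxPart α _ (List.getElem_mem h.1))

lemma pairwise_cells (α : List ℕ) : (cells α).Pairwise Bef := by
  rw [cells, List.pairwise_flatMap]
  refine ⟨fun c _ => ?_, ?_⟩
  · rw [colCells, List.pairwise_filterMap]
    refine List.pairwise_lt_range.imp ?_
    intro a b hab x hx y hy
    split_ifs at hx hy
    simp only [Option.some.injEq] at hx hy
    subst hx; subst hy
    exact Or.inr ⟨rfl, hab⟩
  · refine List.pairwise_lt_range.imp ?_
    intro a b hab x hx y hy
    rw [mem_colCells] at hx hy
    exact Or.inl (by omega)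

lemma nodup_cells (α : List ℕ) : (cells α).Nodup := by
  refine (pairwise_cells α).imp ?_
  rintro a b h rfl
  unfold Bef at h; omega

lemma colList_eq (α : List ℕ) (T : SRCT α) (c : ℕ) : colList α T c = (colCells α c).map (V T) := by
  rw [colList, colCells, List.map_filterMap]
  congr 1; funext r
  split_ifs <;> rfl

lemma colWord_eq (α : List ℕ) (T : SRCT α) : colWord α T = (cells α).map (V T) := by
  simp only [colWord, cells, List.map_flatMap, colList_eq]

/-- Rank of the entry of `x` in its column. -/
def rk (α : List ℕ) (T : SRCT α) (x : ℕ × ℕ) : ℕ :=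
  ((colCells α x.2).filter fun y => decide (V T y ≤ V T x)).length

lemma stWord_eq (α : List ℕ) (T : SRCT α) : stWord α T = (cells α).map (rk α T) := by
  simp only [stWord, cells, List.map_flatMap, colList_eq, stdWord, List.map_map]
  rw [List.flatMap_def, List.flatMap_def]
  congr 1
  apply List.map_congr_left
  intro c _
  apply List.map_congr_left
  intro x hx
  rw [mem_colCells] at hx
  simp only [Function.comp, rk, List.filter_map, List.length_map, hx.2]
  rfl

lemma rk_lt (α : List ℕ) (T : SRCT α) (x y : ℕ × ℕ) (hy : C α y)
    (hc : x.2 = y.2) (h : V T x < V T y) : rk α T x < rk α T y := by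
  unfold rk
  rw [hc, ← List.countP_eq_length_filter, ← List.countP_eq_length_filter]
  have hm : y ∈ colCells α y.2 := (mem_colCells _ _ _).2 ⟨hy, rfl⟩
  obtain ⟨l1, l2, e⟩ := List.append_of_mem hm
  rw [e]
  simp only [List.countP_append, List.countP_cons]
  have m1 : ∀ l : List (ℕ × ℕ), l.countP (fun z => decide (V T z ≤ V T x)) ≤
      l.countP (fun z => decide (V T z ≤ V T y)) := by
    intro l; apply List.countP_mono_left
    intro z _ hz
    simp only [decide_eq_true_eq] at *; omega
  have h1 := m1 l1
  have h2 := m1 l2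
  have h3 : ¬ (V T y ≤ V T x) := by omega
  simp only [h3, decide_false, le_refl, decide_true]
  simp; omega

lemma colEq_of_st (α : List ℕ) (T T' : SRCT α) (h : stWord α T = stWord α T') :
    ColEq α (V T) (V T') := by
  rw [stWord_eq, stWord_eq, List.map_inj_left] at h
  have key : ∀ (T T' : SRCT α), (∀ x ∈ cells α, rk α T x = rk α T' x) →
      ∀ x y, C α x → C α y → x.2 = y.2 → V T x < V T y → V T' x < V T' y := by
    intro T T' h x y hx hy hc hl
    have h1 := rk_lt α T x y hy hc hl
    rw [h x ((mem_cells _ _).2 hx), h y ((mem_cells _ _).2 hy)] at h1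
    by_contra hn
    rcases (not_lt.1 hn).lt_or_eq with hn | hn
    · have := rk_lt α T' y x hx hc.symm hn; omega
    · have := T'.inj _ _ _ _ hx hy hn.symm
      have e : x = y := Prod.ext this.1 this.2
      subst e; omega
  intro x y hx hy hc
  exact ⟨key T T' h x y hx hy hc, key T' T (fun x hx => (h x hx).symm) x y hx hy hc⟩

lemma st_of_colEq (α : List ℕ) (T T' : SRCT α) (h : ColEq α (V T) (V T')) :
    stWord α T = stWord α T' := by
  rw [stWord_eq, stWord_eq, List.map_inj_left]
  intro x hx
  rw [mem_cells] at hx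
  unfold rk
  congr 1
  apply List.filter_congr
  intro y hy
  rw [mem_colCells] at hy
  rw [decide_eq_decide, ← not_lt, ← not_lt, h x y hx hy.1 hy.2.symm]

lemma mem_class (α : List ℕ) (T T' : SRCT α) : T ∈ stClass α T' ↔ ColEq α (V T) (V T') :=
  ⟨colEq_of_st α T T', st_of_colEq α T T'⟩

lemma ColEq.symm {α : List ℕ} {f g : ℕ × ℕ → ℕ} (h : ColEq α f g) : ColEq α g f :=
  fun x y hx hy hc => (h x y hx hy hc).symm

lemma ColEq.trans {α : List ℕ} {f g k : ℕ × ℕ → ℕ} (h : ColEq α f g) (h' : ColEq α g k) :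
    ColEq α f k :=
  fun x y hx hy hc => (h x y hx hy hc).trans (h' x y hx hy hc)

lemma bef_get (α : List ℕ) (p q : ℕ) (hp : p < (cells α).length) (hq : q < (cells α).length) :
    Bef (cells α)[p] (cells α)[q] ↔ p < q := by
  have h := List.pairwise_iff_getElem.1 (pairwise_cells α)
  constructor
  · intro hb
    by_contra hn
    rcases (not_lt.1 hn).lt_or_eq with hn | hn
    · have := h q p hq hp hn
      unfold Bef at *; omega
    · subst hn; unfold Bef at hb; omega
  · exact h p q hp hq

lemma mem_inv_map (α : List ℕ) (f : ℕ × ℕ → ℕ) (p q : ℕ) :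
    (p, q) ∈ invFinset ((cells α).map f) ↔ ∃ (hp : p < (cells α).length)
      (hq : q < (cells α).length), p < q ∧ f (cells α)[q] < f (cells α)[p] := by
  simp only [invFinset, Finset.mem_filter, Finset.mem_product, Finset.mem_range, List.length_map]
  constructor
  · rintro ⟨⟨hp, hq⟩, h, h'⟩
    refine ⟨hp, hq, h, ?_⟩
    rwa [List.getD_eq_getElem _ _ (by simpa using hq), List.getD_eq_getElem _ _ (by simpa using hp),
      List.getElem_map, List.getElem_map] at h'
  · rintro ⟨hp, hq, h, h'⟩
    refine ⟨⟨hp, hq⟩, h, ?_⟩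
    rwa [List.getD_eq_getElem _ _ (by simpa using hq), List.getD_eq_getElem _ _ (by simpa using hp),
      List.getElem_map, List.getElem_map]

lemma inv_subset (α : List ℕ) (f g : ℕ × ℕ → ℕ) :
    invFinset ((cells α).map f) ⊆ invFinset ((cells α).map g) ↔ InvLe α f g := by
  constructor
  · intro h x y hx hy hb hl
    rw [← mem_cells] at hx hy
    obtain ⟨p, hp, rfl⟩ := List.getElem_of_mem hx
    obtain ⟨q, hq, rfl⟩ := List.getElem_of_mem hy
    rw [bef_get] at hb
    have := h ((mem_inv_map α f p q).2 ⟨hp, hq, hb, hl⟩)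
    rw [mem_inv_map] at this
    exact this.2.2.2
  · rintro h ⟨p, q⟩ hm
    rw [mem_inv_map] at hm ⊢
    obtain ⟨hp, hq, hb, hl⟩ := hm
    exact ⟨hp, hq, hb, h _ _ ((mem_cells _ _).1 (List.getElem_mem hp))
      ((mem_cells _ _).1 (List.getElem_mem hq)) ((bef_get α p q hp hq).2 hb) hl⟩

lemma V_inj {α : List ℕ} (T : SRCT α) {x y : ℕ × ℕ} (hx : C α x) (hy : C α y)
    (h : V T x = V T y) : x = y :=
  Prod.ext (T.inj _ _ _ _ hx hy h).1 (T.inj _ _ _ _ hx hy h).2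

lemma V_surj {α : List ℕ} (T : SRCT α) {m : ℕ} (h1 : 1 ≤ m) (h2 : m ≤ α.sum) :
    ∃ x, C α x ∧ V T x = m := by
  obtain ⟨r, c, h, e⟩ := T.surj m h1 h2
  exact ⟨(r, c), h, e⟩

lemma srct_ext {α : List ℕ} (T T' : SRCT α) (h : ∀ x, C α x → V T x = V T' x) : T = T' := by
  have : T.entry = T'.entry := by
    funext r c
    by_cases hc : IsCell α r c
    · exact h (r, c) hc
    · rw [T.zero_off r c hc, T'.zero_off r c hc]
  cases T; cases T'; simp only at this; subst this; rfl

lemma V_word_perm {α : List ℕ} (T : SRCT α) : ((cells α).map (V T)).Perm (List.range' 1 α.sum) := by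
  rw [List.perm_ext_iff_of_nodup]
  · intro m
    simp only [List.mem_map, mem_cells, List.mem_range'_1]
    constructor
    · rintro ⟨x, hx, rfl⟩
      have := T.one_le _ _ hx
      have := T.le_sum _ _ hx
      constructor
      · assumption
      · show T.entry x.1 x.2 < _
        omega
    · rintro ⟨h1, h2⟩
      exact V_surj T h1 (by omega)
  · refine List.Nodup.map_on ?_ (nodup_cells α)
    intro x hx y hy h
    exact V_inj T ((mem_cells _ _).1 hx) ((mem_cells _ _).1 hy) h
  · exact List.nodup_range'

lemma length_cells {α : List ℕ} (T : SRCT α) : (cells α).length = α.sum := by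
  have := (V_word_perm T).length_eq
  simpa using this

lemma cell_left {α : List ℕ} {r c : ℕ} (h : IsCell α r (c + 1)) : IsCell α r c :=
  ⟨h.1, by have := h.2; omega⟩

end WB
namespace WB

lemma bef_of_col {x y : ℕ × ℕ} (h : x.2 < y.2) : Bef x y := Or.inl h

lemma bef_total {x y : ℕ × ℕ} (h : x ≠ y) : Bef x y ∨ Bef y x := by
  unfold Bef
  by_contra hn
  exact h (Prod.ext (by omega) (by omega))

lemma bef_irrefl (x : ℕ × ℕ) : ¬ Bef x x := by unfold Bef; omega

lemma bef_asymm {x y : ℕ × ℕ} (h : Bef x y) : ¬ Bef y x := by unfold Bef at *; omega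

lemma bef_trans {x y z : ℕ × ℕ} (h : Bef x y) (h' : Bef y z) : Bef x z := by
  unfold Bef at *; omega

/-- Swapping a non-attacking descent yields a tableau. -/
lemma exists_swap {α : List ℕ} (T : SRCT α) (x y : ℕ × ℕ) (hx : C α x) (hy : C α y)
    (hv : V T y = V T x + 1) (hc : x.2 < y.2) (hna : ¬ (y.2 = x.2 + 1 ∧ x.1 < y.1)) :
    ∃ T' : SRCT α, SRCTstep α T T' ∧ ∀ z, V T' z = if V T z = V T x then V T x + 1
      else if V T z = V T x + 1 then V T x else V T z := by
  have hx1 := T.one_le _ _ hx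
  have hy1 := T.le_sum _ _ hy
  obtain ⟨i, hi⟩ : ∃ i, V T x = i := ⟨_, rfl⟩
  rw [hi] at hv ⊢
  have hi' : T.entry x.1 x.2 = i := hi
  have hv' : T.entry y.1 y.2 = i + 1 := hv
  have ux : ∀ r c, IsCell α r c → T.entry r c = i → r = x.1 ∧ c = x.2 := fun r c h e =>
    T.inj _ _ _ _ h hx (e.trans hi'.symm)
  have uy : ∀ r c, IsCell α r c → T.entry r c = i + 1 → r = y.1 ∧ c = y.2 := fun r c h e =>
    T.inj _ _ _ _ h hy (e.trans hv'.symm)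
  have samecol : ∀ r r' c, IsCell α r c → IsCell α r' c → T.entry r c < T.entry r' c →
      swapEntry α T i r c < swapEntry α T i r' c := by
    intro r r' c h h' hl
    have a1 := ux r c h
    have a2 := uy r c h
    have a3 := ux r' c h'
    have a4 := uy r' c h'
    unfold swapEntry
    split_ifs <;> omega
  refine ⟨⟨swapEntry α T i, ?_, ?_, ?_, ?_, ?_, ?_, ?_, ?_⟩, ⟨i, ?_, ?_, rfl⟩, fun z => rfl⟩
  · intro r c h
    have := T.zero_off r c h
    unfold swapEntry; split_ifs <;> omega
  · intro r c h
    have := T.one_le r c h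
    unfold swapEntry; split_ifs <;> omega
  · intro r c h
    have := T.le_sum r c h
    unfold swapEntry; split_ifs <;> omega
  · intro r c r' c' h h' e
    apply T.inj r c r' c' h h'
    unfold swapEntry at e; split_ifs at e <;> omega
  · intro m h1 h2
    by_cases e1 : m = i
    · exact ⟨y.1, y.2, hy, by unfold swapEntry; split_ifs <;> omega⟩
    by_cases e2 : m = i + 1
    · exact ⟨x.1, x.2, hx, by unfold swapEntry; split_ifs <;> omega⟩
    obtain ⟨r, c, h, e⟩ := T.surj m h1 h2
    exact ⟨r, c, h, by unfold swapEntry; split_ifs <;> omega⟩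
  · intro r c h
    have h' := cell_left h
    have := T.row_dec r c h
    have a1 := ux r (c + 1) h
    have a2 := uy r c h'
    unfold swapEntry; split_ifs <;> omega
  · intro r r' hr h h'
    exact samecol _ _ _ h h' (T.col1_inc r r' hr h h')
  · intro r r' c hr h h' hl
    by_cases ho : T.entry r' (c + 1) < T.entry r c
    · obtain ⟨g1, g2⟩ := T.triple r r' c hr h h' ho
      exact ⟨g1, samecol _ _ _ h' g1 g2⟩
    · exfalso
      have a1 := ux r c h
      have a2 := uy r' (c + 1) h'
      have ne : T.entry r' (c + 1) ≠ T.entry r c := fun e => by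
        have := T.inj _ _ _ _ h' h e; omega
      unfold swapEntry at hl; split_ifs at hl <;> omega
  · exact ⟨x.1, x.2, y.1, y.2, hx, hy, hi', hv', hc.le⟩
  · rintro ⟨r, c, r', c', h, h', e, e', ha⟩
    have a1 := ux r c h e
    have a2 := uy r' c' h' e'
    omega

lemma step_data {α : List ℕ} {T T' : SRCT α} (h : SRCTstep α T T') :
    ∃ i x y, C α x ∧ C α y ∧ V T x = i ∧ V T y = i + 1 ∧ x.2 < y.2 ∧
      ∀ z, V T' z = if V T z = i then i + 1 else if V T z = i + 1 then i else V T z := by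
  obtain ⟨i, ⟨r, c, r', c', h, h', e, e', hl⟩, hna, he⟩ := h
  refine ⟨i, (r, c), (r', c'), h, h', e, e', ?_, ?_⟩
  · by_contra hn
    exact hna ⟨r, c, r', c', h, h', e, e', Or.inl (by simp only at hn; omega)⟩
  · intro z
    show T'.entry z.1 z.2 = _
    rw [he]; rfl

lemma step_colEq {α : List ℕ} {T T' : SRCT α} (h : SRCTstep α T T') :
    ColEq α (V T) (V T') := by
  obtain ⟨i, x, y, hx, hy, ex, ey, hc, hT⟩ := step_data h
  intro u v hu hv huv
  have a1 : V T u = i → u = x := fun e => V_inj T hu hx (e.trans ex.symm)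
  have a2 : V T u = i + 1 → u = y := fun e => V_inj T hu hy (e.trans ey.symm)
  have a3 : V T v = i → v = x := fun e => V_inj T hv hx (e.trans ex.symm)
  have a4 : V T v = i + 1 → v = y := fun e => V_inj T hv hy (e.trans ey.symm)
  have b1 : ¬ (V T u = i ∧ V T v = i + 1) := by
    rintro ⟨h1, h2⟩; rw [a1 h1, a4 h2] at huv; omega
  have b2 : ¬ (V T u = i + 1 ∧ V T v = i) := by
    rintro ⟨h1, h2⟩; rw [a2 h1, a3 h2] at huv; omega
  rw [hT u, hT v]
  split_ifs <;> omega

lemma step_invLe {α : List ℕ} {T T' : SRCT α} (h : SRCTstep α T T') :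
    InvLe α (V T) (V T') := by
  obtain ⟨i, x, y, hx, hy, ex, ey, hc, hT⟩ := step_data h
  intro u v hu hv huv hl
  have a2 : V T u = i + 1 → u = y := fun e => V_inj T hu hy (e.trans ey.symm)
  have a3 : V T v = i → v = x := fun e => V_inj T hv hx (e.trans ex.symm)
  have b2 : ¬ (V T u = i + 1 ∧ V T v = i) := by
    rintro ⟨h1, h2⟩; rw [a2 h1, a3 h2] at huv
    unfold Bef at huv; omega
  rw [hT u, hT v]
  split_ifs <;> omega

lemma step_count {α : List ℕ} {T T' : SRCT α} (h : SRCTstep α T T') :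
    invCount (colWord α T') = invCount (colWord α T) + 1 := by
  obtain ⟨i, x, y, hx, hy, ex, ey, hc, hT⟩ := step_data h
  obtain ⟨p, hp, px⟩ := List.getElem_of_mem ((mem_cells α x).2 hx)
  obtain ⟨q, hq, qy⟩ := List.getElem_of_mem ((mem_cells α y).2 hy)
  have hpq : p < q := by
    rw [← bef_get α p q hp hq, px, qy]; exact bef_of_col hc
  rw [colWord_eq, colWord_eq, invCount, invCount]
  have hnot : (p, q) ∉ invFinset ((cells α).map (V T)) := by
    rw [mem_inv_map]
    rintro ⟨_, _, _, h⟩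
    rw [px, qy] at h; omega
  rw [← Finset.card_insert_of_notMem hnot]
  congr 1
  ext ⟨u, v⟩
  rw [Finset.mem_insert, mem_inv_map, mem_inv_map]
  have g : ∀ (u : ℕ) (hu : u < (cells α).length), (V T (cells α)[u] = i → u = p) ∧
      (V T (cells α)[u] = i + 1 → u = q) := by
    intro u hu
    have cu := (mem_cells α _).1 (List.getElem_mem hu)
    constructor
    · intro e
      have := V_inj T cu hx (e.trans ex.symm)
      rw [← px] at this
      exact (nodup_cells α).getElem_inj_iff.1 this
    · intro e
      have := V_inj T cu hy (e.trans ey.symm)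
      rw [← qy] at this
      exact (nodup_cells α).getElem_inj_iff.1 this
  constructor
  · rintro ⟨hu, hv, huv, hl⟩
    rw [hT, hT] at hl
    obtain ⟨g1, g2⟩ := g u hu
    obtain ⟨g3, g4⟩ := g v hv
    by_cases hlt : V T (cells α)[v] < V T (cells α)[u]
    · exact Or.inr ⟨hu, hv, huv, hlt⟩
    · left
      have ne : V T (cells α)[v] ≠ V T (cells α)[u] := fun e => by
        have := V_inj T ((mem_cells α _).1 (List.getElem_mem hv))
          ((mem_cells α _).1 (List.getElem_mem hu)) e
        have := (nodup_cells α).getElem_inj_iff.1 this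
        omega
      have : V T (cells α)[u] = i ∧ V T (cells α)[v] = i + 1 := by
        split_ifs at hl <;> omega
      rw [g1 this.1, g4 this.2]
  · rintro (e | ⟨hu, hv, huv, hl⟩)
    · simp only [Prod.mk.injEq] at e
      obtain ⟨rfl, rfl⟩ := e
      refine ⟨hp, hq, hpq, ?_⟩
      rw [hT, hT, px, qy, ex, ey]
      split_ifs <;> omega
    · refine ⟨hu, hv, huv, ?_⟩
      exact step_invLe h _ _ ((mem_cells α _).1 (List.getElem_mem hu))
          ((mem_cells α _).1 (List.getElem_mem hv)) ((bef_get α u v hu hv).2 huv) hl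

lemma le_colEq {α : List ℕ} {T T' : SRCT α} (h : SRCTle α T T') : ColEq α (V T) (V T') := by
  induction h with
  | refl => exact fun _ _ _ _ _ => Iff.rfl
  | tail _ h ih => exact ih.trans (step_colEq h)

lemma le_invLe {α : List ℕ} {T T' : SRCT α} (h : SRCTle α T T') : InvLe α (V T) (V T') := by
  induction h with
  | refl => exact fun _ _ _ _ _ h => h
  | tail _ h ih => exact fun x y hx hy hb hl => step_invLe h x y hx hy hb (ih x y hx hy hb hl)

/-- If two tableaux differ, some consecutive pair is out of order in the second. -/
lemma exists_adjacent {α : List ℕ} (a b : SRCT α) (hne : a ≠ b) :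
    ∃ x y, C α x ∧ C α y ∧ V a y = V a x + 1 ∧ V b y < V b x := by
  by_contra hn
  have hn' : ∀ x y, C α x → C α y → V a y = V a x + 1 → V b x < V b y := by
    intro x y hx hy e
    by_contra h
    rcases (not_lt.1 h).lt_or_eq with h | h
    · exact hn ⟨x, y, hx, hy, e, h⟩
    · rw [V_inj b hy hx h] at e; omega
  apply hne
  apply srct_ext
  have lo : ∀ k x, C α x → V a x = k → k ≤ V b x := by
    intro k
    induction k with
    | zero => intros; omega
    | succ k ih =>
      intro x hx e
      have b1 := b.one_le _ _ hx
      by_cases hk : k = 0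
      · subst hk; exact b1
      obtain ⟨z, hz, ez⟩ := V_surj a (m := k) (by omega)
        (by have := a.le_sum _ _ hx; simp only [V] at e; omega)
      have h1 := ih z hz ez
      have h2 := hn' z x hz hx (by omega)
      omega
  have hi : ∀ k x, C α x → V a x + k = α.sum → V b x + k ≤ α.sum := by
    intro k
    induction k with
    | zero => intro x hx _; exact b.le_sum _ _ hx
    | succ k ih =>
      intro x hx e
      obtain ⟨z, hz, ez⟩ := V_surj a (m := V a x + 1) (by omega) (by omega)
      have h1 := ih z hz (by omega)
      have h2 := hn' x z hx hz ez
      omega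
  intro x hx
  have h1 := lo _ x hx rfl
  have h3 : V a x ≤ α.sum := a.le_sum _ _ hx
  have h2 := hi (α.sum - V a x) x hx (by omega)
  omega

lemma count_le {α : List ℕ} {a b : SRCT α} (h : InvLe α (V a) (V b)) :
    invCount (colWord α a) ≤ invCount (colWord α b) := by
  rw [colWord_eq, colWord_eq]
  exact Finset.card_le_card ((inv_subset α _ _).2 h)

lemma le_of_invLe {α : List ℕ} (b : SRCT α) : ∀ (k : ℕ) (a : SRCT α), ColEq α (V a) (V b) →
    InvLe α (V a) (V b) → invCount (colWord α b) = invCount (colWord α a) + k →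
    SRCTle α a b := by
  intro k
  induction k with
  | zero =>
    intro a hc hi hk
    have : a = b := by
      by_contra hne
      obtain ⟨x, y, hx, hy, e, hl⟩ := exists_adjacent a b hne
      have hxy : x ≠ y := by rintro rfl; omega
      have hb : Bef x y := by
        rcases bef_total hxy with h | h
        · exact h
        · have := hi y x hy hx h (by omega); omega
      have hs : invFinset (colWord α a) = invFinset (colWord α b) := by
        apply Finset.eq_of_subset_of_card_le
        · rw [colWord_eq, colWord_eq]; exact (inv_subset α _ _).2 hi
        · exact hk.le
      have : InvLe α (V b) (V a) := by
        rw [← inv_subset, ← colWord_eq, ← colWord_eq, hs]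
      have := this x y hx hy hb hl
      omega
    subst this; exact Relation.ReflTransGen.refl
  | succ k ih =>
    intro a hc hi hk
    have hne : a ≠ b := by rintro rfl; omega
    obtain ⟨x, y, hx, hy, e, hl⟩ := exists_adjacent a b hne
    have hxy : x ≠ y := by rintro rfl; omega
    have hb : Bef x y := by
      rcases bef_total hxy with h | h
      · exact h
      · have := hi y x hy hx h (by omega); omega
    have hcol : x.2 < y.2 := by
      rcases hb with h | h
      · exact h
      · have := (hc x y hx hy h.1).1 (by omega); omega
    have hna : ¬ (y.2 = x.2 + 1 ∧ x.1 < y.1) := by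
      rintro ⟨h1, h2⟩
      have hy' : IsCell α y.1 (x.2 + 1) := by rw [← h1]; exact hy
      obtain ⟨g1, g2⟩ := b.triple x.1 y.1 x.2 h2 hx hy' (by rw [← h1]; exact hl)
      have g3 := (hc y (x.1, x.2 + 1) hy g1 h1).2 (by
        show b.entry y.1 y.2 < b.entry x.1 (x.2 + 1)
        rw [h1]; exact g2)
      have g4 := a.row_dec x.1 x.2 g1
      simp only [V] at *
      omega
    obtain ⟨a', hs, hT⟩ := exists_swap a x y hx hy e hcol hna
    have hi' : InvLe α (V a') (V b) := by
      intro u v hu hv huv hlt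
      by_cases ho : V a v < V a u
      · exact hi u v hu hv huv ho
      have ne : V a v ≠ V a u := fun e => by
        rw [V_inj a hv hu e] at huv; exact bef_irrefl _ huv
      rw [hT, hT] at hlt
      have : V a u = V a x ∧ V a v = V a x + 1 := by
        split_ifs at hlt <;> omega
      rw [V_inj a hu hx this.1, V_inj a hv hy (by omega)]
      exact hl
    exact Relation.ReflTransGen.head hs
      (ih a' ((step_colEq hs).symm.trans hc) hi' (by have := step_count hs; omega))

end WB
namespace WB

lemma sink_passage {α : List ℕ} (T : SRCT α) (hs : IsSink α T) (c : ℕ) (y : ℕ × ℕ) (hy : C α y)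
    (hcy : c < y.2) : ∀ (d : ℕ) (x : ℕ × ℕ), C α x → x.2 ≤ c → V T x + d = V T y →
    ∃ u v, C α u ∧ C α v ∧ u.2 = c ∧ v.2 = c + 1 ∧ u.1 < v.1 ∧ V T x ≤ V T u ∧
      V T v = V T u + 1 ∧ V T v ≤ V T y := by
  intro d
  induction d with
  | zero =>
    intro x hx hc e
    have := V_inj T hx hy (by omega)
    subst this; omega
  | succ d ih =>
    intro x hx hc e
    have hyn : V T y ≤ α.sum := T.le_sum _ _ hy
    obtain ⟨z, hz, ez⟩ := V_surj T (m := V T x + 1) (by omega) (by omega)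
    by_cases hzc : z.2 ≤ c
    · obtain ⟨u, v, h1, h2, h3, h4, h5, h6, h7, h8⟩ := ih z hz hzc (by omega)
      exact ⟨u, v, h1, h2, h3, h4, h5, by omega, h7, h8⟩
    · obtain ⟨r, c0, r', c', h, h', e1, e2, ha⟩ := hs (V T x)
        ⟨x.1, x.2, z.1, z.2, hx, hz, rfl, ez, by omega⟩
      have a1 := T.inj _ _ _ _ h hx e1
      have a2 := T.inj _ _ _ _ h' hz (e2.trans ez.symm)
      exact ⟨x, z, hx, hz, by omega, by omega, by omega, le_rfl, ez, by omega⟩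

lemma source_passage {α : List ℕ} (T : SRCT α) (hs : IsSource α T) (c : ℕ) (x : ℕ × ℕ)
    (hx : C α x) (hcx : x.2 ≤ c) : ∀ (d : ℕ) (y : ℕ × ℕ), C α y → c + 1 ≤ y.2 →
    V T y + d = V T x → ∃ r, IsCell α r (c + 1) ∧ V T y ≤ V T (r, c + 1) ∧
      V T (r, c) ≤ V T x := by
  intro d
  induction d with
  | zero =>
    intro y hy hc e
    have := V_inj T hy hx (by omega)
    subst this; omega
  | succ d ih =>
    intro y hy hc e
    have hxn : V T x ≤ α.sum := T.le_sum _ _ hx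
    have hy1 : 1 ≤ V T y := T.one_le _ _ hy
    obtain ⟨z, hz, ez⟩ := V_surj T (m := V T y + 1) (by omega) (by omega)
    by_cases hzc : c + 1 ≤ z.2
    · obtain ⟨r, h1, h2, h3⟩ := ih z hz hzc (by omega)
      exact ⟨r, h1, by omega, h3⟩
    · have hnd : ¬ Descent α T (V T y) := by
        rintro ⟨r, c0, r', c', h, h', e1, e2, ha⟩
        have a1 := T.inj _ _ _ _ h hy e1
        have a2 := T.inj _ _ _ _ h' hz (e2.trans ez.symm)
        omega
      obtain ⟨r, c0, h, e1, e2⟩ := hs (V T y) hy1 (by omega) hnd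
      have a1 := T.inj _ _ _ _ h hy e2
      have a2 := T.inj _ _ _ _ (cell_left h) hz (e1.trans ez.symm)
      have : c0 = c := by omega
      subst this
      exact ⟨r, h, e2.ge, by simp only [V] at *; omega⟩

lemma colEq_le {α : List ℕ} {T T' : SRCT α} (h : ColEq α (V T) (V T')) {x y : ℕ × ℕ} (hx : C α x)
    (hy : C α y) (hc : x.2 = y.2) (hl : V T x ≤ V T y) : V T' x ≤ V T' y := by
  by_contra hn
  have := (h y x hy hx hc.symm).2 (not_le.1 hn)
  omega

lemma sink_max {α : List ℕ} (T T1 : SRCT α) (hs : IsSink α T1) (hc : ColEq α (V T1) (V T)) :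
    InvLe α (V T) (V T1) := by
  have key : ∀ (k : ℕ) (x y : ℕ × ℕ), C α x → C α y → y.2 = x.2 + k → V T1 x ≤ V T1 y →
      V T x ≤ V T y := by
    intro k
    induction k with
    | zero => intro x y hx hy e hl; exact colEq_le hc hx hy e.symm hl
    | succ k ih =>
      intro x y hx hy e hl
      obtain ⟨u, v, hu, hv, h1, h2, h3, h4, h5, h6⟩ := sink_passage T1 hs x.2 y hy (by omega)
        (V T1 y - V T1 x) x hx le_rfl (by omega)
      have g1 := colEq_le hc hx hu h1.symm h4
      have g2 := ih v y hv hy (by omega) h6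
      have g3 : V T u ≤ V T v := by
        by_contra hn
        have e1 : v.2 = u.2 + 1 := by omega
        have hv' : IsCell α v.1 (u.2 + 1) := by rw [← e1]; exact hv
        obtain ⟨q1, q2⟩ := T.triple u.1 v.1 u.2 h3 hu hv' (by rw [← e1]; exact not_le.1 hn)
        have q3 := (hc v (u.1, u.2 + 1) hv q1 e1).2 (by
          show T.entry v.1 v.2 < T.entry u.1 (u.2 + 1)
          rw [e1]; exact q2)
        have q4 := T1.row_dec u.1 u.2 q1
        simp only [V] at *
        omega
      omega
  intro x y hx hy hb hl
  by_contra hn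
  have h1 : x.2 ≤ y.2 := by unfold Bef at hb; omega
  have := key (y.2 - x.2) x y hx hy (by omega) (by omega)
  omega

lemma source_min {α : List ℕ} (T T0 : SRCT α) (hs : IsSource α T0) (hc : ColEq α (V T0) (V T)) :
    InvLe α (V T0) (V T) := by
  have key : ∀ (k : ℕ) (x y : ℕ × ℕ), C α x → C α y → y.2 = x.2 + k → V T0 y ≤ V T0 x →
      V T y ≤ V T x := by
    intro k
    induction k with
    | zero => intro x y hx hy e hl; exact colEq_le hc hy hx e hl
    | succ k ih =>
      intro x y hx hy e hl
      obtain ⟨r, h1, h2, h3⟩ := source_passage T0 hs (x.2 + k) x hx (by omega)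
        (V T0 x - V T0 y) y hy (by omega) (by omega)
      have g1 := colEq_le hc hy (y := (r, x.2 + k + 1)) h1 (by simp only; omega) h2
      have g2 := ih x (r, x.2 + k) hx (cell_left h1) rfl h3
      have g3 := T.row_dec _ _ h1
      simp only [V] at *
      omega
  intro x y hx hy hb hl
  by_contra hn
  have h1 : x.2 ≤ y.2 := by unfold Bef at hb; omega
  have h2 := key (y.2 - x.2) x y hx hy (by omega) (by omega)
  have h3 := V_inj T hx hy (by omega)
  subst h3
  exact bef_irrefl _ hb

lemma colEq_of_between {α : List ℕ} (T0 T1 : SRCT α) (F : ℕ × ℕ → ℕ)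
    (hc : ColEq α (V T1) (V T0)) (hinj : ∀ x y, C α x → C α y → F x = F y → x = y)
    (h0 : InvLe α (V T0) F) (h1 : InvLe α F (V T1)) : ColEq α F (V T0) := by
  have key : ∀ x y, C α x → C α y → x.2 = y.2 → x.1 < y.1 →
      (F y < F x ↔ V T0 y < V T0 x) := by
    intro x y hx hy he hl
    have hb : Bef x y := Or.inr ⟨he, hl⟩
    exact ⟨fun h => (hc y x hy hx he.symm).1 (h1 x y hx hy hb h), h0 x y hx hy hb⟩
  intro x y hx hy he
  by_cases hxy : x = y
  · subst hxy; simp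
  have n1 : F x ≠ F y := fun e => hxy (hinj x y hx hy e)
  have n2 : V T0 x ≠ V T0 y := fun e => hxy (V_inj T0 hx hy e)
  have n3 : x.1 ≠ y.1 := fun e => hxy (Prod.ext e he)
  rcases lt_or_gt_of_ne n3 with h | h
  · have := key x y hx hy he h
    omega
  · exact key y x hy hx he.symm h

lemma mk_between {α : List ℕ} (T0 T1 : SRCT α) (F : ℕ × ℕ → ℕ)
    (hc : ColEq α (V T1) (V T0)) (hinj : ∀ x y, C α x → C α y → F x = F y → x = y)
    (hF1 : ∀ x, C α x → 1 ≤ F x) (hF2 : ∀ x, C α x → F x ≤ α.sum)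
    (h0 : InvLe α (V T0) F) (h1 : InvLe α F (V T1)) :
    ∃ T : SRCT α, ColEq α (V T) (V T0) ∧ ∀ x, C α x → V T x = F x := by
  have hce := colEq_of_between T0 T1 F hc hinj h0 h1
  let G : ℕ → ℕ → ℕ := fun r c => if IsCell α r c then F (r, c) else 0
  have hG : ∀ r c, IsCell α r c → G r c = F (r, c) := fun r c h => if_pos h
  have himg : (cells α).toFinset.image F = Finset.Icc 1 α.sum := by
    apply Finset.eq_of_subset_of_card_le
    · intro m hm
      simp only [Finset.mem_image, List.mem_toFinset, mem_cells] at hm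
      obtain ⟨x, hx, rfl⟩ := hm
      exact Finset.mem_Icc.2 ⟨hF1 x hx, hF2 x hx⟩
    · rw [Finset.card_image_of_injOn, List.toFinset_card_of_nodup (nodup_cells α), length_cells T0]
      · simp
      · intro x hx y hy e
        simp only [Finset.mem_coe, List.mem_toFinset, mem_cells] at hx hy
        exact hinj x y hx hy e
  refine ⟨⟨G, ?_, ?_, ?_, ?_, ?_, ?_, ?_, ?_⟩, ?_, ?_⟩
  · intro r c h; exact if_neg h
  · intro r c h; rw [hG r c h]; exact hF1 _ h
  · intro r c h; rw [hG r c h]; exact hF2 _ h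
  · intro r c r' c' h h' e
    rw [hG r c h, hG r' c' h'] at e
    have := hinj (r, c) (r', c') h h' e
    simpa using this
  · intro m h1 h2
    have : m ∈ (cells α).toFinset.image F := by rw [himg]; exact Finset.mem_Icc.2 ⟨h1, h2⟩
    simp only [Finset.mem_image, List.mem_toFinset, mem_cells] at this
    obtain ⟨x, hx, e⟩ := this
    exact ⟨x.1, x.2, hx, by rw [hG _ _ hx]; exact e⟩
  · intro r c h
    rw [hG _ _ h, hG _ _ (cell_left h)]
    exact h0 (r, c) (r, c + 1) (cell_left h) h (Or.inl (Nat.lt_succ_self c)) (T0.row_dec r c h)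
  · intro r r' hr h h'
    rw [hG _ _ h, hG _ _ h']
    exact (hce (r, 0) (r', 0) h h' rfl).2 (T0.col1_inc r r' hr h h')
  · intro r r' c hr h h' hl
    rw [hG _ _ h, hG _ _ h'] at hl
    obtain ⟨g1, g2⟩ := T1.triple r r' c hr h h'
      (h1 (r, c) (r', c + 1) h h' (Or.inl (Nat.lt_succ_self c)) hl)
    refine ⟨g1, ?_⟩
    rw [hG _ _ g1, hG _ _ h']
    exact (hce (r', c + 1) (r, c + 1) h' g1 rfl).2 ((hc (r', c + 1) (r, c + 1) h' g1 rfl).1 g2)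
  · intro x y hx hy he
    rw [← hce x y hx hy he]
    show G x.1 x.2 < G y.1 y.2 ↔ _
    rw [hG _ _ hx, hG _ _ hy]
  · intro x hx
    exact hG _ _ hx

/-- A transitive and co-transitive relation is the inversion set of a ranking. -/
lemma exists_rank (α : List ℕ) (R : ℕ × ℕ → ℕ × ℕ → Prop)
    (hB : ∀ x y, R x y → Bef x y)
    (ht : ∀ x y z, C α x → C α y → C α z → R x y → R y z → R x z)
    (hco : ∀ x y z, C α x → C α y → C α z → Bef x y → Bef y z → R x z → R x y ∨ R y z) :
    ∃ F : ℕ × ℕ → ℕ, (∀ x y, C α x → C α y → F x = F y → x = y) ∧ (∀ x, C α x → 1 ≤ F x) ∧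
      (∀ x, C α x → F x ≤ (cells α).length) ∧
      ∀ x y, C α x → C α y → Bef x y → (F y < F x ↔ R x y) := by
  classical
  let P : ℕ × ℕ → ℕ × ℕ → Prop := fun x y => (Bef x y ∧ ¬ R x y) ∨ R y x
  have Pirr : ∀ x, ¬ P x x := by
    rintro x (h | h)
    · exact bef_irrefl _ h.1
    · exact bef_irrefl _ (hB _ _ h)
  have Ptot : ∀ x y, x ≠ y → P x y ∨ P y x := by
    intro x y hne
    rcases bef_total hne with h | h
    · by_cases hr : R x y
      · exact Or.inr (Or.inr hr)
      · exact Or.inl (Or.inl ⟨h, hr⟩)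
    · by_cases hr : R y x
      · exact Or.inl (Or.inr hr)
      · exact Or.inr (Or.inl ⟨h, hr⟩)
  have Ptr : ∀ x y z, C α x → C α y → C α z → P x y → P y z → P x z := by
    intro x y z hx hy hz h h'
    rcases h with ⟨b1, n1⟩ | r1 <;> rcases h' with ⟨b2, n2⟩ | r2
    · refine Or.inl ⟨bef_trans b1 b2, fun h => ?_⟩
      rcases hco x y z hx hy hz b1 b2 h with h | h
      · exact n1 h
      · exact n2 h
    · have hne : x ≠ z := by rintro rfl; exact n1 r2
      rcases bef_total hne with b | b
      · exact Or.inl ⟨b, fun h => n1 (ht x z y hx hz hy h r2)⟩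
      · rcases hco z x y hz hx hy b b1 r2 with h | h
        · exact Or.inr h
        · exact absurd h n1
    · have hne : x ≠ z := by rintro rfl; exact n2 r1
      rcases bef_total hne with b | b
      · exact Or.inl ⟨b, fun h => n2 (ht y x z hy hx hz r1 h)⟩
      · rcases hco y z x hy hz hx b2 b r1 with h | h
        · exact absurd h n2
        · exact Or.inr h
    · exact Or.inr (ht z y x hz hy hx r2 r1)
  let K := (cells α).toFinset
  have hK : ∀ x, x ∈ K ↔ C α x := fun x => by rw [List.mem_toFinset, mem_cells]
  let F : ℕ × ℕ → ℕ := fun x => (K.filter fun y => P y x).card + 1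
  have Fmono : ∀ x y, C α x → C α y → P x y → F x < F y := by
    intro x y hx hy h
    apply Nat.succ_lt_succ
    apply Finset.card_lt_card
    rw [Finset.ssubset_iff_of_subset]
    · exact ⟨x, Finset.mem_filter.2 ⟨(hK x).2 hx, h⟩, fun hm => Pirr x (Finset.mem_filter.1 hm).2⟩
    · intro z hz
      rw [Finset.mem_filter] at hz ⊢
      exact ⟨hz.1, Ptr z x y ((hK z).1 hz.1) hx hy hz.2 h⟩
  refine ⟨F, ?_, ?_, ?_, ?_⟩
  · intro x y hx hy e
    by_contra hne
    rcases Ptot x y hne with h | h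
    · have := Fmono _ _ hx hy h; omega
    · have := Fmono _ _ hy hx h; omega
  · intro x _; exact Nat.succ_le_succ (Nat.zero_le _)
  · intro x hx
    rw [← List.toFinset_card_of_nodup (nodup_cells α)]
    apply Nat.succ_le_of_lt
    apply Finset.card_lt_card
    rw [Finset.ssubset_iff_of_subset (Finset.filter_subset _ _)]
    exact ⟨x, (hK x).2 hx, fun hm => Pirr x (Finset.mem_filter.1 hm).2⟩
  · intro x y hx hy hb
    constructor
    · intro h
      by_contra hn
      have := Fmono x y hx hy (Or.inl ⟨hb, hn⟩); omega
    · intro h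
      exact Fmono y x hy hx (Or.inr h)

/-- Transitive closure of a co-transitive edge relation. -/
lemma transGen_props (α : List ℕ) (E : ℕ × ℕ → ℕ × ℕ → Prop)
    (hB : ∀ x y, E x y → Bef x y)
    (hco : ∀ x y z, C α y → Bef x y → Bef y z → E x z → E x y ∨ E y z) :
    (∀ x y, Relation.TransGen E x y → Bef x y) ∧
    ∀ x y z, C α y → Bef x y → Bef y z → Relation.TransGen E x z →
      Relation.TransGen E x y ∨ Relation.TransGen E y z := by
  constructor
  · intro x y h
    induction h with
    | single h => exact hB _ _ h
    | tail _ h ih => exact bef_trans ih (hB _ _ h)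
  · intro x y z hy hxy hyz h
    induction h with
    | single h =>
      rcases hco _ _ _ hy hxy hyz h with h | h
      · exact Or.inl (.single h)
      · exact Or.inr (.single h)
    | @tail w z h1 h2 ih =>
      by_cases hyw : y = w
      · subst hyw; exact Or.inl h1
      rcases bef_total hyw with hb | hb
      · rcases ih hb with h | h
        · exact Or.inl h
        · exact Or.inr (h.tail h2)
      · rcases hco _ _ _ hy hb hyz h2 with h | h
        · exact Or.inl (h1.tail h)
        · exact Or.inr (.single h)

lemma invLe_le {α : List ℕ} {a b : SRCT α} (hc : ColEq α (V a) (V b)) (h : InvLe α (V a) (V b)) :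
    SRCTle α a b :=
  le_of_invLe b (invCount (colWord α b) - invCount (colWord α a)) a hc h
    (by have := count_le h; omega)

lemma invLe_congr {α : List ℕ} {f f' g g' : ℕ × ℕ → ℕ} (hf : ∀ x, C α x → f x = f' x)
    (hg : ∀ x, C α x → g x = g' x) (h : InvLe α f g) : InvLe α f' g' := by
  intro x y hx hy hb hl
  rw [← hg x hx, ← hg y hy]
  exact h x y hx hy hb (by rw [hf x hx, hf y hy]; exact hl)

lemma exists_join {α : List ℕ} (T0 T1 a b : SRCT α) (hc : ColEq α (V T1) (V T0))
    (ha0 : InvLe α (V T0) (V a)) (ha1 : InvLe α (V a) (V T1)) (hb1 : InvLe α (V b) (V T1)) :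
    ∃ j : SRCT α, ColEq α (V j) (V T0) ∧ InvLe α (V a) (V j) ∧ InvLe α (V b) (V j) ∧
      ∀ c : SRCT α, InvLe α (V a) (V c) → InvLe α (V b) (V c) → InvLe α (V j) (V c) := by
  let E : ℕ × ℕ → ℕ × ℕ → Prop := fun x y =>
    Bef x y ∧ C α x ∧ C α y ∧ (V a y < V a x ∨ V b y < V b x)
  obtain ⟨p1, p2⟩ := transGen_props α E (fun x y h => h.1) (by
    rintro x y z hy h1 h2 ⟨_, hx, hz, h⟩
    by_cases g : V a y < V a x ∨ V b y < V b x
    · exact Or.inl ⟨h1, hx, hy, g⟩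
    · exact Or.inr ⟨h2, hy, hz, by omega⟩)
  obtain ⟨F, f1, f2, f3, f4⟩ := exists_rank α (Relation.TransGen E) p1
    (fun x y z _ _ _ h h' => h.trans h') (fun x y z _ hy _ => p2 x y z hy)
  have univ : ∀ c : SRCT α, InvLe α (V a) (V c) → InvLe α (V b) (V c) → InvLe α F (V c) := by
    intro c hac hbc x y hx hy hb hl
    rw [f4 x y hx hy hb] at hl
    clear hb hx hy
    induction hl with
    | single h =>
      obtain ⟨h1, h2, h3, h4 | h4⟩ := h
      · exact hac _ _ h2 h3 h1 h4
      · exact hbc _ _ h2 h3 h1 h4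
    | tail _ h ih =>
      refine lt_trans ?_ ih
      obtain ⟨h1, h2, h3, h4 | h4⟩ := h
      · exact hac _ _ h2 h3 h1 h4
      · exact hbc _ _ h2 h3 h1 h4
  have haF : InvLe α (V a) F := fun x y hx hy hb hl =>
    (f4 x y hx hy hb).2 (.single ⟨hb, hx, hy, Or.inl hl⟩)
  have hbF : InvLe α (V b) F := fun x y hx hy hb hl =>
    (f4 x y hx hy hb).2 (.single ⟨hb, hx, hy, Or.inr hl⟩)
  obtain ⟨j, hj, hjF⟩ := mk_between T0 T1 F hc f1 f2 (by rw [← length_cells T0]; exact f3)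
    (fun x y hx hy hb hl => haF x y hx hy hb (ha0 x y hx hy hb hl)) (univ T1 ha1 hb1)
  exact ⟨j, hj, invLe_congr (fun _ _ => rfl) (fun x hx => (hjF x hx).symm) haF,
    invLe_congr (fun _ _ => rfl) (fun x hx => (hjF x hx).symm) hbF,
    fun c h1 h2 => invLe_congr (fun x hx => (hjF x hx).symm) (fun _ _ => rfl) (univ c h1 h2)⟩

lemma exists_meet {α : List ℕ} (T0 T1 a b : SRCT α) (hc : ColEq α (V T1) (V T0))
    (ha0 : InvLe α (V T0) (V a)) (hb0 : InvLe α (V T0) (V b)) (ha1 : InvLe α (V a) (V T1)) :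
    ∃ j : SRCT α, ColEq α (V j) (V T0) ∧ InvLe α (V j) (V a) ∧ InvLe α (V j) (V b) ∧
      ∀ c : SRCT α, InvLe α (V c) (V a) → InvLe α (V c) (V b) → InvLe α (V c) (V j) := by
  let E : ℕ × ℕ → ℕ × ℕ → Prop := fun x y =>
    Bef x y ∧ C α x ∧ C α y ∧ (V a x < V a y ∨ V b x < V b y)
  obtain ⟨p1, p2⟩ := transGen_props α E (fun x y h => h.1) (by
    rintro x y z hy h1 h2 ⟨_, hx, hz, h⟩
    by_cases g : V a x < V a y ∨ V b x < V b y
    · exact Or.inl ⟨h1, hx, hy, g⟩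
    · exact Or.inr ⟨h2, hy, hz, by omega⟩)
  obtain ⟨F, f1, f2, f3, f4⟩ := exists_rank α (fun x y => Bef x y ∧ ¬ Relation.TransGen E x y)
    (fun x y h => h.1)
    (fun x y z _ hy _ h h' => ⟨bef_trans h.1 h'.1, fun hn => by
      rcases p2 x y z hy h.1 h'.1 hn with q | q
      · exact h.2 q
      · exact h'.2 q⟩)
    (fun x y z _ _ _ h1 h2 h => by
      by_contra hn
      rw [not_or] at hn
      have q1 : Relation.TransGen E x y := by
        by_contra q; exact hn.1 ⟨h1, q⟩
      have q2 : Relation.TransGen E y z := by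
        by_contra q; exact hn.2 ⟨h2, q⟩
      exact h.2 (q1.trans q2))
  have lt_of_not : ∀ (T : SRCT α) x y, C α x → C α y → Bef x y → ¬ V T x < V T y →
      V T y < V T x := by
    intro T x y hx hy hb h
    rcases (not_lt.1 h).lt_or_eq with h | h
    · exact h
    · rw [V_inj T hy hx h] at hb; exact absurd hb (bef_irrefl _)
  have flip : ∀ (c d : SRCT α), InvLe α (V c) (V d) → ∀ x y, C α x → C α y → Bef x y →
      V d x < V d y → V c x < V c y := by
    intro c d h x y hx hy hb hl
    by_contra hn
    have := h x y hx hy hb (lt_of_not c x y hx hy hb hn)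
    omega
  have univ : ∀ c : SRCT α, InvLe α (V c) (V a) → InvLe α (V c) (V b) → InvLe α (V c) F := by
    intro c hac hbc x y hx hy hb hl
    rw [f4 x y hx hy hb]
    refine ⟨hb, fun hn => ?_⟩
    have : V c x < V c y := by
      clear hb hx hy hl
      induction hn with
      | single h =>
        obtain ⟨h1, h2, h3, h4 | h4⟩ := h
        · exact flip c a hac _ _ h2 h3 h1 h4
        · exact flip c b hbc _ _ h2 h3 h1 h4
      | tail _ h ih =>
        refine lt_trans ih ?_
        obtain ⟨h1, h2, h3, h4 | h4⟩ := h
        · exact flip c a hac _ _ h2 h3 h1 h4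
        · exact flip c b hbc _ _ h2 h3 h1 h4
    omega
  have haF : InvLe α F (V a) := fun x y hx hy hb hl => by
    have h := ((f4 x y hx hy hb).1 hl).2
    refine lt_of_not a x y hx hy hb fun q => h (.single ⟨hb, hx, hy, Or.inl q⟩)
  have hbF : InvLe α F (V b) := fun x y hx hy hb hl => by
    have h := ((f4 x y hx hy hb).1 hl).2
    refine lt_of_not b x y hx hy hb fun q => h (.single ⟨hb, hx, hy, Or.inr q⟩)
  obtain ⟨j, hj, hjF⟩ := mk_between T0 T1 F hc f1 f2 (by rw [← length_cells T0]; exact f3)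
    (univ T0 ha0 hb0) (fun x y hx hy hb hl => ha1 x y hx hy hb (haF x y hx hy hb hl))
  exact ⟨j, hj, invLe_congr (fun x hx => (hjF x hx).symm) (fun _ _ => rfl) haF,
    invLe_congr (fun x hx => (hjF x hx).symm) (fun _ _ => rfl) hbF,
    fun c h1 h2 => invLe_congr (fun _ _ => rfl) (fun x hx => (hjF x hx).symm) (univ c h1 h2)⟩

/-- Any word of the right length is read off from a filling. -/
lemma exists_fill (α : List ℕ) (w : List ℕ) (h : w.length = (cells α).length) :
    ∃ F : ℕ × ℕ → ℕ, (cells α).map F = w := by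
  refine ⟨fun x => w.getD ((cells α).idxOf x) 0, ?_⟩
  apply List.ext_getElem
  · simp [h]
  · intro i h1 h2
    rw [List.getElem_map, (nodup_cells α).idxOf_getElem, List.getD_eq_getElem _ _ h2]

end WB

/-- Each `∼_α`-equivalence class, ordered by `⪯_α`, is a graded lattice, and the column word
map is a poset isomorphism onto the interval `[col_{τ₀}, col_{τ₁}]` of the symmetric group
under the left weak Bruhat order (inversion-set containment of one-line words). -/
theorem class_is_weak_bruhat_interval (n : ℕ) (α : List ℕ) (hpos : ∀ a ∈ α, 0 < a)
    (hsum : α.sum = n) (T0 T1 : SRCT α) (hcl : T1 ∈ stClass α T0)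
    (hsrc : IsSource α T0) (hsink : IsSink α T1) :
    (∀ a ∈ stClass α T0, ∀ b ∈ stClass α T0, ∃ j ∈ stClass α T0,
        SRCTle α a j ∧ SRCTle α b j ∧
        ∀ c ∈ stClass α T0, SRCTle α a c → SRCTle α b c → SRCTle α j c) ∧
    (∀ a ∈ stClass α T0, ∀ b ∈ stClass α T0, ∃ m ∈ stClass α T0,
        SRCTle α m a ∧ SRCTle α m b ∧
        ∀ c ∈ stClass α T0, SRCTle α c a → SRCTle α c b → SRCTle α c m) ∧
    (∃ ρ : SRCT α → ℕ, ρ T0 = 0 ∧ ∀ a ∈ stClass α T0, ∀ b ∈ stClass α T0,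
        (SRCTle α a b ∧ a ≠ b ∧
          ∀ c ∈ stClass α T0, SRCTle α a c → SRCTle α c b → c = a ∨ c = b) →
        ρ b = ρ a + 1) ∧
    (∀ a ∈ stClass α T0, ∀ b ∈ stClass α T0,
        (SRCTle α a b ↔ invFinset (colWord α a) ⊆ invFinset (colWord α b))) ∧
    (∀ a ∈ stClass α T0, ∀ b ∈ stClass α T0, colWord α a = colWord α b → a = b) ∧
    colWord α '' stClass α T0 =
      {w : List ℕ | w.Perm (List.range' 1 n) ∧
        invFinset (colWord α T0) ⊆ invFinset w ∧ invFinset w ⊆ invFinset (colWord α T1)} := by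
  have hc1 : WB.ColEq α (WB.V T1) (WB.V T0) := (WB.mem_class α T1 T0).1 hcl
  have lo : ∀ a ∈ stClass α T0, WB.InvLe α (WB.V T0) (WB.V a) := fun a ha =>
    WB.source_min a T0 hsrc ((WB.mem_class α a T0).1 ha).symm
  have hi : ∀ a ∈ stClass α T0, WB.InvLe α (WB.V a) (WB.V T1) := fun a ha =>
    WB.sink_max a T1 hsink (hc1.trans ((WB.mem_class α a T0).1 ha).symm)
  have iff_le : ∀ a ∈ stClass α T0, ∀ b ∈ stClass α T0,
      (SRCTle α a b ↔ WB.InvLe α (WB.V a) (WB.V b)) := fun a ha b hb =>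
    ⟨WB.le_invLe, WB.invLe_le (((WB.mem_class α a T0).1 ha).trans
      ((WB.mem_class α b T0).1 hb).symm)⟩
  refine ⟨?_, ?_, ?_, ?_, ?_, ?_⟩
  · intro a ha b hb
    obtain ⟨j, hj, h1, h2, h3⟩ := WB.exists_join T0 T1 a b hc1 (lo a ha) (hi a ha) (hi b hb)
    have hj' := (WB.mem_class α j T0).2 hj
    refine ⟨j, hj', (iff_le a ha j hj').2 h1, (iff_le b hb j hj').2 h2, ?_⟩
    intro c hc h4 h5
    exact (iff_le j hj' c hc).2 (h3 c (WB.le_invLe h4) (WB.le_invLe h5))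
  · intro a ha b hb
    obtain ⟨j, hj, h1, h2, h3⟩ := WB.exists_meet T0 T1 a b hc1 (lo a ha) (lo b hb) (hi a ha)
    have hj' := (WB.mem_class α j T0).2 hj
    refine ⟨j, hj', (iff_le j hj' a ha).2 h1, (iff_le j hj' b hb).2 h2, ?_⟩
    intro c hc h4 h5
    exact (iff_le c hc j hj').2 (h3 c (WB.le_invLe h4) (WB.le_invLe h5))
  · refine ⟨fun T => invCount (colWord α T) - invCount (colWord α T0), by simp, ?_⟩
    rintro a ha b hb ⟨hab, hne, hcov⟩
    rcases Relation.ReflTransGen.cases_head hab with h | ⟨c, hac, hcb⟩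
    · exact absurd h hne
    · have hcn := WB.step_count hac
      have hcm : c ∈ stClass α T0 := (WB.mem_class α c T0).2
        ((WB.step_colEq hac).symm.trans ((WB.mem_class α a T0).1 ha))
      have hl := WB.count_le (lo a ha)
      rcases hcov c hcm (Relation.ReflTransGen.single hac) hcb with h | h
      · subst h; omega
      · subst h; simp only; omega
  · intro a ha b hb
    rw [iff_le a ha b hb, WB.colWord_eq, WB.colWord_eq, WB.inv_subset]
  · intro a _ b _ h
    rw [WB.colWord_eq, WB.colWord_eq, List.map_inj_left] at h
    exact WB.srct_ext a b fun x hx => h x ((WB.mem_cells α x).2 hx)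
  · ext w
    simp only [Set.mem_image, Set.mem_setOf_eq]
    constructor
    · rintro ⟨T, hT, rfl⟩
      rw [WB.colWord_eq, WB.colWord_eq, WB.colWord_eq, WB.inv_subset, WB.inv_subset, ← hsum]
      exact ⟨WB.V_word_perm T, lo T hT, hi T hT⟩
    · rintro ⟨hp, h0, h1⟩
      have hlen : w.length = (WB.cells α).length := by
        rw [hp.length_eq, List.length_range', WB.length_cells T0, hsum]
      obtain ⟨F, rfl⟩ := WB.exists_fill α w hlen
      rw [WB.colWord_eq, WB.inv_subset] at h0 h1
      have hnd : ((WB.cells α).map F).Nodup := hp.nodup_iff.2 List.nodup_range'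
      have hmem : ∀ x, WB.C α x → 1 ≤ F x ∧ F x ≤ α.sum := by
        intro x hx
        have := hp.mem_iff.1 (List.mem_map_of_mem (f := F) ((WB.mem_cells α x).2 hx))
        rw [List.mem_range'_1] at this
        omega
      obtain ⟨T, hT, hTF⟩ := WB.mk_between T0 T1 F hc1
        (fun x y hx hy e => List.inj_on_of_nodup_map hnd ((WB.mem_cells α x).2 hx)
          ((WB.mem_cells α y).2 hy) e)
        (fun x hx => (hmem x hx).1) (fun x hx => (hmem x hx).2) h0 h1
      refine ⟨T, (WB.mem_class α T T0).2 hT, ?_⟩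
      rw [WB.colWord_eq, List.map_inj_left]
      exact fun x hx => hTF x ((WB.mem_cells α x).1 hx)
end

section
/- Let α ⊨ n and let S_α be the complex vector space with basis SRCT(α), equipped with the H_n(0)-module structure in which the generators act by the operators π_i (1 ≤ i ≤ n−1). Then S_α is an indecomposable H_n(0)-module if and only if α is a simple composition; equivalently, every idempotent C-linear endomorphism of S_α commuting with all the operators π_i is either the zero map or the identity map, if and only if α is simple. -/
/-- `P` is the family of linear operators induced by the `0`-Hecke operators `π_i` on the
complex vector space with basis `SRCT α`:  `π_i τ = τ` if `i ∉ des(τ)`, `π_i τ = 0` if `i` is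
an attacking descent, and `π_i τ = s_i(τ)` if `i` is a non-attacking descent. -/
def PiChar (α : List ℕ) (P : ℕ → Module.End ℂ (SRCT α →₀ ℂ)) : Prop :=
  ∀ i : ℕ, 1 ≤ i → i < α.sum → ∀ T : SRCT α,
    (¬ Descent α T i → P i (Finsupp.single T 1) = Finsupp.single T 1) ∧
    (Descent α T i → Attacking α T i → P i (Finsupp.single T 1) = 0) ∧
    (Descent α T i → ¬ Attacking α T i →
      ∃ T' : SRCT α, T'.entry = swapEntry α T i ∧
        P i (Finsupp.single T 1) = Finsupp.single T' 1)

/-- A composition is simple if whenever `α_i ≥ α_j ≥ 2` with `i < j` there is `i < k < j`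
with `α_k = α_j - 1` (0-indexed parts). -/
def SimpleComp (α : List ℕ) : Prop :=
  ∀ i j, i < j → j < α.length → 2 ≤ α.getD j 0 → α.getD j 0 ≤ α.getD i 0 →
    ∃ k, i < k ∧ k < j ∧ α.getD k 0 = α.getD j 0 - 1

/-- The part of `α` with (0-indexed) index `j` has a removable node. -/
def HasRemovable (α : List ℕ) (j : ℕ) : Prop :=
  j < α.length ∧ (j = 0 ∨ (2 ≤ α.getD j 0 ∧ ∀ i < j, α.getD i 0 ≠ α.getD j 0 - 1))

theorem SRCT.ext_entry {α : List ℕ} {S T : SRCT α} (h : S.entry = T.entry) : S = T := by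
  cases S; cases T; simp only at h; subst h; rfl

/-- Partial sums of the composition. -/
def psum (α : List ℕ) (r : ℕ) : ℕ := (α.take r).sum

theorem psum_succ (α : List ℕ) (r : ℕ) : psum α (r + 1) = psum α r + α.getD r 0 := by
  unfold psum
  rw [List.take_add_one, List.sum_append, List.getD_eq_getElem?_getD]
  cases α[r]? <;> simp

theorem psum_mono (α : List ℕ) : Monotone (psum α) :=
  monotone_nat_of_le_succ fun r => by rw [psum_succ]; omega

theorem psum_length (α : List ℕ) : psum α α.length = α.sum := by simp [psum]

theorem psum_find (α : List ℕ) (m : ℕ) (h1 : 1 ≤ m) (r : ℕ) (h : m ≤ psum α r) :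
    ∃ r' c, r' < r ∧ c < α.getD r' 0 ∧ m + c = psum α (r' + 1) := by
  induction r with
  | zero => simp [psum] at h; omega
  | succ r ih =>
    by_cases hm : m ≤ psum α r
    · obtain ⟨r', c, h1, h2, h3⟩ := ih hm
      exact ⟨r', c, by omega, h2, h3⟩
    · have := psum_succ α r
      exact ⟨r, psum α (r + 1) - m, by omega, by omega, by omega⟩

theorem getD_pos' {α : List ℕ} (hpos : ∀ a ∈ α, 0 < a) {r : ℕ} (h : r < α.length) :
    0 < α.getD r 0 := by
  rw [List.getD_eq_getElem _ _ h]
  exact hpos _ (List.getElem_mem h)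

theorem row_mono {α : List ℕ} (T : SRCT α) (r c d : ℕ) (h : IsCell α r (c + d)) :
    T.entry r (c + d) + d ≤ T.entry r c := by
  induction d with
  | zero => simp
  | succ d ih =>
    have h1 := T.row_dec r (c + d) h
    have h2 := ih ⟨h.1, by have := h.2; omega⟩
    have : c + (d + 1) = c + d + 1 := by omega
    rw [this]; omega

/-- A tableau whose first column is bounded by the partial sums is the canonical one. -/
theorem entry_of_bound {α : List ℕ} (T : SRCT α)
    (hb : ∀ r, r < α.length → T.entry r 0 ≤ psum α (r + 1)) :
    ∀ r c, IsCell α r c → T.entry r c + c = psum α (r + 1) := by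
  intro r
  induction r using Nat.strong_induction_on with
  | _ r ih =>
    have low : ∀ c, IsCell α r c → psum α r < T.entry r c := by
      intro c hc
      by_contra hle
      obtain ⟨r', c', h1, h2, h3⟩ := psum_find α _ (T.one_le r c hc) r (by omega)
      have hc' : IsCell α r' c' := ⟨by have := hc.1; omega, h2⟩
      have h4 := ih r' h1 c' hc'
      have := T.inj r c r' c' hc hc' (by omega)
      omega
    intro c hc
    have h1 := row_mono T r 0 c (by simpa using hc)
    simp only [zero_add] at h1
    have h2 := hb r hc.1
    have hlt := hc.2
    obtain ⟨d, hd⟩ : ∃ d, α.getD r 0 = c + d + 1 := ⟨α.getD r 0 - c - 1, by omega⟩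
    have hl : IsCell α r (c + d) := ⟨hc.1, by omega⟩
    have h3 := row_mono T r c d hl
    have h4 := low _ hl
    have h5 := psum_succ α r
    omega

/-- Downward induction for bounding the first column. -/
theorem bound_of_step {α : List ℕ} (hpos : ∀ a ∈ α, 0 < a) (T : SRCT α)
    (hs : ∀ r, r + 1 < α.length → T.entry (r + 1) 0 ≤ psum α (r + 1 + 1) →
      T.entry r 0 ≤ psum α (r + 1)) :
    ∀ r, r < α.length → T.entry r 0 ≤ psum α (r + 1) := by
  have : ∀ d r, r + d + 1 = α.length → T.entry r 0 ≤ psum α (r + 1) := by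
    intro d
    induction d with
    | zero =>
      intro r h
      have h1 := T.le_sum r 0 ⟨by omega, getD_pos' hpos (by omega)⟩
      have : r + 1 = α.length := by omega
      rw [this, psum_length]; exact h1
    | succ d ih =>
      intro r h
      exact hs r (by omega) (ih (r + 1) (by omega))
  intro r hr
  exact this (α.length - r - 1) r (by omega)

theorem bound_of_des {α : List ℕ} (hpos : ∀ a ∈ α, 0 < a) (T : SRCT α)
    (hd : ∀ i, 1 ≤ i → i < α.sum → Descent α T i → ∃ r, i = psum α r) :
    ∀ r, r < α.length → T.entry r 0 ≤ psum α (r + 1) := by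
  apply bound_of_step hpos
  intro r hr hb
  by_contra hlt
  have c0 : IsCell α r 0 := ⟨by omega, getD_pos' hpos (by omega)⟩
  have c1 : IsCell α (r + 1) 0 := ⟨by omega, getD_pos' hpos (by omega)⟩
  have h1 := T.col1_inc r (r + 1) (by omega) c0 c1
  have h2 := T.le_sum _ _ c1
  obtain ⟨x, y, hxy, he⟩ := T.surj (T.entry r 0 + 1) (by omega) (by omega)
  obtain ⟨k, hk⟩ := hd (T.entry r 0) (T.one_le _ _ c0) (by omega)
    ⟨r, 0, x, y, c0, hxy, rfl, he, by omega⟩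
  rcases Nat.lt_or_ge k (r + 2) with h | h
  · have := psum_mono α (show k ≤ r + 1 by omega); omega
  · have := psum_mono α h
    have e : r + 1 + 1 = r + 2 := rfl
    rw [e] at hb
    omega

theorem bound_of_consec {α : List ℕ} (hpos : ∀ a ∈ α, 0 < a) (T : SRCT α)
    (hc : ∀ r c, IsCell α r (c + 1) → T.entry r c = T.entry r (c + 1) + 1) :
    ∀ r, r < α.length → T.entry r 0 ≤ psum α (r + 1) := by
  have hrow : ∀ r c, IsCell α r c → T.entry r c + c = T.entry r 0 := by
    intro r c
    induction c with
    | zero => intro _; rfl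
    | succ c ih =>
      intro h
      have h1 := hc r c h
      have h2 := ih ⟨h.1, by have := h.2; omega⟩
      omega
  apply bound_of_step hpos
  intro r hr hb
  by_contra hlt
  have c0 : IsCell α r 0 := ⟨by omega, getD_pos' hpos (by omega)⟩
  have c1 : IsCell α (r + 1) 0 := ⟨by omega, getD_pos' hpos (by omega)⟩
  have h1 := T.col1_inc r (r + 1) (by omega) c0 c1
  have h2 := psum_succ α (r + 1)
  have c2 : IsCell α (r + 1) (T.entry (r + 1) 0 - T.entry r 0) := ⟨by omega, by omega⟩
  have h3 := hrow _ _ c2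
  have := T.inj _ _ _ _ c0 c2 (by omega)
  omega

/-- The canonical tableau. -/
def canon (α : List ℕ) (hpos : ∀ a ∈ α, 0 < a) : SRCT α where
  entry r c := if IsCell α r c then psum α (r + 1) - c else 0
  zero_off r c h := by simp [h]
  one_le r c h := by
    have := psum_succ α r; have := h.2; simp only [h, if_true]; omega
  le_sum r c h := by
    have h1 := psum_mono α (show r + 1 ≤ α.length from h.1)
    rw [psum_length] at h1; simp only [h, if_true]; omega
  inj r c r' c' h h' e := by
    simp only [h, h', if_true] at e
    have h1 := psum_succ α r; have h2 := psum_succ α r'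
    have h3 := h.2; have h4 := h'.2
    rcases Nat.lt_trichotomy r r' with hr | hr | hr
    · have := psum_mono α (show r + 1 ≤ r' from hr); omega
    · subst hr; omega
    · have := psum_mono α (show r' + 1 ≤ r from hr); omega
  surj m h1 h2 := by
    obtain ⟨r, c, h3, h4, h5⟩ := psum_find α m h1 α.length (by rw [psum_length]; exact h2)
    have h : IsCell α r c := ⟨h3, h4⟩
    exact ⟨r, c, h, by simp only [h, if_true]; omega⟩
  row_dec r c h := by
    have h' : IsCell α r c := ⟨h.1, by have := h.2; omega⟩
    have := psum_succ α r; have := h.2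
    simp only [h, h', if_true]; omega
  col1_inc r r' hr h h' := by
    simp only [h, h', if_true]
    have h1 := psum_succ α r'
    have h2 := h'.2
    have := psum_mono α (show r + 1 ≤ r' from hr); omega
  triple r r' c hr h h' e := by
    exfalso
    simp only [h, h', if_true] at e
    have h1 := psum_succ α r'
    have h2 := h'.2
    have := psum_mono α (show r + 1 ≤ r' from hr); omega

theorem canon_entry (α : List ℕ) (hpos : ∀ a ∈ α, 0 < a) (r c : ℕ) (h : IsCell α r c) :
    (canon α hpos).entry r c + c = psum α (r + 1) := by
  have := psum_succ α r; have := h.2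
  simp only [canon, h, if_true]; omega

theorem eq_canon {α : List ℕ} (hpos : ∀ a ∈ α, 0 < a) (T : SRCT α)
    (hb : ∀ r, r < α.length → T.entry r 0 ≤ psum α (r + 1)) : T = canon α hpos := by
  apply SRCT.ext_entry
  funext r c
  by_cases h : IsCell α r c
  · have h1 := entry_of_bound T hb r c h
    have h2 := canon_entry α hpos r c h
    omega
  · rw [T.zero_off r c h, (canon α hpos).zero_off r c h]

theorem canon_des {α : List ℕ} (hpos : ∀ a ∈ α, 0 < a) (i : ℕ)
    (h : Descent α (canon α hpos) i) : ∃ r, i = psum α r := by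
  obtain ⟨r, c, r', c', h1, h2, e1, e2, hc⟩ := h
  have h3 := canon_entry α hpos r c h1
  cases c with
  | zero => exact ⟨r + 1, by omega⟩
  | succ c =>
    exfalso
    have h4 : IsCell α r c := ⟨h1.1, by have := h1.2; omega⟩
    have h5 := canon_entry α hpos r c h4
    have := (canon α hpos).inj _ _ _ _ h4 h2 (by omega)
    omega

/-- In a simple composition, all columns of all tableaux increase. -/
theorem col_inc {α : List ℕ} (hpos : ∀ a ∈ α, 0 < a) (hs : SimpleComp α) (T : SRCT α)
    (c i j : ℕ) (hij : i < j) (hi : IsCell α i c) (hj : IsCell α j c) :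
    T.entry i c < T.entry j c := by
  have key : ∀ c i j, i < j → IsCell α i c → j < α.length → α.getD j 0 = c + 1 →
      T.entry i c < T.entry j c := by
    intro c
    induction c with
    | zero => intro i j hij hi hj e; exact T.col1_inc i j hij hi ⟨hj, by omega⟩
    | succ c ih =>
      intro i j hij hi hj e
      have := hi.2
      obtain ⟨k, h1, h2, h3⟩ := hs i j hij hj (by omega) (by omega)
      have hi' : IsCell α i c := ⟨hi.1, by omega⟩
      have hk : IsCell α k c := ⟨by omega, by omega⟩
      have h4 := ih i k h1 hi' hk.1 (by omega)
      have h5 := T.row_dec i c hi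
      by_contra h6
      have h7 := T.triple k j c h2 hk ⟨hj, by omega⟩ (by omega)
      have := h7.1.2
      omega
  have : ∀ d c, α.getD j 0 = c + 1 + d → IsCell α i c → T.entry i c < T.entry j c := by
    intro d
    induction d with
    | zero => intro c e hi; exact key c i j hij hi hj.1 e
    | succ d ih =>
      intro c e hi
      by_contra hlt
      have hj1 : IsCell α j (c + 1) := ⟨hj.1, by omega⟩
      have h1 := T.row_dec j c hj1
      have h2 := T.triple i j c hij hi hj1 (by omega)
      have h3 := ih (c + 1) (by omega) h2.1
      omega
  have hjlt := hj.2
  exact this (α.getD j 0 - c - 1) c (by omega) hi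

/-- If no backward move is possible and columns increase, rows are consecutive. -/
theorem consec_of_source {α : List ℕ} (T : SRCT α)
    (hcol : ∀ c i j, i < j → IsCell α i c → IsCell α j c → T.entry i c < T.entry j c)
    (hsrc : ∀ r c r' c', IsCell α r c → IsCell α r' c' → T.entry r c = T.entry r' c' + 1 →
      c < c' → r = r' ∧ c' = c + 1) :
    ∀ r c, IsCell α r (c + 1) → T.entry r c = T.entry r (c + 1) + 1 := by
  intro r c h
  have h' : IsCell α r c := ⟨h.1, by have := h.2; omega⟩
  have hlt := T.row_dec r c h
  have hle := T.le_sum r c h'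
  by_contra hne
  have claim : ∀ d, T.entry r (c + 1) + 1 + d < T.entry r c → ∀ x y, IsCell α x y →
      T.entry x y = T.entry r (c + 1) + 1 + d → c + 1 ≤ y := by
    intro d
    induction d with
    | zero =>
      intro hd x y hxy e
      by_contra hy
      obtain ⟨h1, h2⟩ := hsrc x y r (c + 1) hxy h (by omega) (by omega)
      have : y = c := by omega
      subst h1 this
      omega
    | succ d ih =>
      intro hd x y hxy e
      obtain ⟨x', y', hxy', e'⟩ := T.surj (T.entry r (c + 1) + 1 + d) (by omega) (by omega)
      have h1 := ih (by omega) x' y' hxy' e'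
      by_contra hy
      obtain ⟨h2, h3⟩ := hsrc x y x' y' hxy hxy' (by omega) (by omega)
      have : y = c := by omega
      subst h2 this h3
      rcases Nat.lt_trichotomy r x with hr | hr | hr
      · have := hcol y r x hr h' hxy; omega
      · subst hr; omega
      · have := hcol (y + 1) x r hr hxy' h; omega
  obtain ⟨x, y, hxy, e⟩ := T.surj (T.entry r c - 1) (by omega) (by omega)
  have h1 := claim (T.entry r c - 2 - T.entry r (c + 1)) (by omega) x y hxy (by omega)
  obtain ⟨h2, h3⟩ := hsrc r c x y h' hxy (by omega) (by omega)
  subst h2 h3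
  omega

/-- The backward move. -/
theorem exists_backward_swap {α : List ℕ} (T : SRCT α) (i r c r' c' : ℕ) (h : IsCell α r c)
    (h' : IsCell α r' c') (e : T.entry r c = i + 1) (e' : T.entry r' c' = i)
    (hc : c < c') (hn : ¬ (r = r' ∧ c' = c + 1)) :
    ∃ S : SRCT α, S.entry = swapEntry α T i ∧ ¬ (c' = c + 1 ∧ r < r') := by
  have hna : ¬ (c' = c + 1 ∧ r < r') := by
    rintro ⟨rfl, hr⟩
    have h1 := T.triple r r' c hr h h' (by omega)
    have h2 := T.row_dec r c h1.1
    omega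
  have hi1 : 1 ≤ i := by have := T.one_le _ _ h'; omega
  have hi2 : i + 1 ≤ α.sum := by have := T.le_sum _ _ h; omega
  have pos1 : ∀ x y, IsCell α x y → T.entry x y = i + 1 → x = r ∧ y = c := fun x y hx hy =>
    T.inj _ _ _ _ hx h (by omega)
  have pos0 : ∀ x y, IsCell α x y → T.entry x y = i → x = r' ∧ y = c' := fun x y hx hy =>
    T.inj _ _ _ _ hx h' (by omega)
  have lt_iff : ∀ x y x' y', IsCell α x y → IsCell α x' y' →
      (y' = y ∨ (y' = y + 1 ∧ x ≤ x')) →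
      ((swapEntry α T i x y < swapEntry α T i x' y' ↔ T.entry x y < T.entry x' y') ∧
       (swapEntry α T i x' y' < swapEntry α T i x y ↔ T.entry x' y' < T.entry x y)) := by
    intro x y x' y' hx hx' hy
    have a1 := pos1 x y hx
    have a2 := pos1 x' y' hx'
    have b1 := pos0 x y hx
    have b2 := pos0 x' y' hx'
    unfold swapEntry
    split_ifs <;> omega
  refine ⟨⟨swapEntry α T i, ?_, ?_, ?_, ?_, ?_, ?_, ?_, ?_⟩, rfl, hna⟩
  · intro x y hx
    have := T.zero_off x y hx
    unfold swapEntry; split_ifs <;> omega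
  · intro x y hx
    have := T.one_le x y hx
    unfold swapEntry; split_ifs <;> omega
  · intro x y hx
    have := T.le_sum x y hx
    unfold swapEntry; split_ifs <;> omega
  · intro x y x' y' hx hx' he
    apply T.inj x y x' y' hx hx'
    unfold swapEntry at he; split_ifs at he <;> omega
  · intro m h1 h2
    by_cases m1 : m = i
    · exact ⟨r, c, h, by unfold swapEntry; split_ifs <;> omega⟩
    by_cases m2 : m = i + 1
    · exact ⟨r', c', h', by unfold swapEntry; split_ifs <;> omega⟩
    obtain ⟨x, y, hx, hy⟩ := T.surj m h1 h2
    exact ⟨x, y, hx, by unfold swapEntry; split_ifs <;> omega⟩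
  · intro x y hx
    have hx' : IsCell α x y := ⟨hx.1, by have := hx.2; omega⟩
    exact (lt_iff x y x (y + 1) hx' hx (by omega)).2.2 (T.row_dec x y hx)
  · intro x x' hlt hx hx'
    exact (lt_iff x 0 x' 0 hx hx' (by omega)).1.2 (T.col1_inc x x' hlt hx hx')
  · intro x x' y hlt hx hx' he
    have h1 := T.triple x x' y hlt hx hx' ((lt_iff x y x' (y + 1) hx hx' (by omega)).2.1 he)
    exact ⟨h1.1, (lt_iff x (y + 1) x' (y + 1) h1.1 hx' (by omega)).2.2 h1.2⟩

/-- The set of cells. -/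
def cells (α : List ℕ) : Finset (ℕ × ℕ) :=
  (Finset.range α.length ×ˢ Finset.range (α.sum + 1)).filter fun p => IsCell α p.1 p.2

theorem mem_cells (α : List ℕ) (p : ℕ × ℕ) : p ∈ cells α ↔ IsCell α p.1 p.2 := by
  simp only [cells, Finset.mem_filter, Finset.mem_product, Finset.mem_range]
  refine ⟨fun h => h.2, fun h => ⟨⟨h.1, ?_⟩, h⟩⟩
  have h1 := psum_mono α (show p.1 + 1 ≤ α.length from h.1)
  have h2 := psum_succ α p.1
  have h3 := h.2
  rw [psum_length] at h1
  omega

/-- A potential function bounded above that increases under backward moves. -/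
def pot (α : List ℕ) (T : SRCT α) : ℕ := ∑ p ∈ cells α, p.2 * T.entry p.1 p.2

theorem pot_le (α : List ℕ) (T : SRCT α) : pot α T ≤ ∑ p ∈ cells α, p.2 * α.sum :=
  Finset.sum_le_sum fun p hp =>
    Nat.mul_le_mul_left _ (T.le_sum _ _ ((mem_cells α p).1 hp))

theorem pot_lt {α : List ℕ} (S T : SRCT α) (i r c r' c' : ℕ) (h : IsCell α r c)
    (h' : IsCell α r' c') (e : T.entry r c = i + 1) (e' : T.entry r' c' = i)
    (hc : c < c') (hS : S.entry = swapEntry α T i) : pot α T < pot α S := by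
  have key : ∀ p ∈ cells α, p.2 * S.entry p.1 p.2 + (if p = (r, c) then c else 0) =
      p.2 * T.entry p.1 p.2 + (if p = (r', c') then c' else 0) := by
    rintro ⟨x, y⟩ hp
    have hx := (mem_cells α _).1 hp
    simp only at hx
    rw [hS]
    simp only [swapEntry, Prod.mk.injEq]
    by_cases a1 : x = r ∧ y = c
    · obtain ⟨rfl, rfl⟩ := a1
      have : ¬ (x = r' ∧ y = c') := by omega
      simp only [this, e]
      simp
      ring
    by_cases a2 : x = r' ∧ y = c'
    · obtain ⟨rfl, rfl⟩ := a2
      simp only [a1, e']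
      simp
      ring
    have b1 : T.entry x y ≠ i := fun he => a2 (T.inj _ _ _ _ hx h' (by omega))
    have b2 : T.entry x y ≠ i + 1 := fun he => a1 (T.inj _ _ _ _ hx h (by omega))
    simp [a1, a2, b1, b2]
  have hsum := Finset.sum_congr rfl key
  rw [Finset.sum_add_distrib, Finset.sum_add_distrib, Finset.sum_ite_eq', Finset.sum_ite_eq',
    if_pos ((mem_cells α _).2 h), if_pos ((mem_cells α _).2 h')] at hsum
  unfold pot
  omega

/-- Every non-canonical tableau is the image under some `P i` of one with larger potential. -/
theorem exists_pred {α : List ℕ} (hpos : ∀ a ∈ α, 0 < a) (hs : SimpleComp α)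
    (P : ℕ → Module.End ℂ (SRCT α →₀ ℂ)) (hP : PiChar α P) (T : SRCT α)
    (hT : T ≠ canon α hpos) :
    ∃ S i, pot α T < pot α S ∧ 1 ≤ i ∧ i < α.sum ∧
      P i (Finsupp.single S 1) = Finsupp.single T 1 := by
  have hex : ∃ r c r' c', IsCell α r c ∧ IsCell α r' c' ∧ T.entry r c = T.entry r' c' + 1 ∧
      c < c' ∧ ¬ (r = r' ∧ c' = c + 1) := by
    by_contra hno
    apply hT
    apply eq_canon
    apply bound_of_consec hpos
    apply consec_of_source T (fun c i j => col_inc hpos hs T c i j)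
    intro r c r' c' h h' e hc
    by_contra hn
    exact hno ⟨r, c, r', c', h, h', e, hc, hn⟩
  obtain ⟨r, c, r', c', h, h', e, hc, hn⟩ := hex
  obtain ⟨S, hS, hna⟩ := exists_backward_swap T _ r c r' c' h h' e rfl hc hn
  have hle := T.le_sum _ _ h
  have hi := T.one_le _ _ h'
  generalize hgi : T.entry r' c' = i at *
  refine ⟨S, i, pot_lt S T i r c r' c' h h' e hgi hc hS, hi, by omega, ?_⟩
  have s0 : S.entry r c = i := by rw [hS]; unfold swapEntry; split_ifs <;> omega
  have s1 : S.entry r' c' = i + 1 := by rw [hS]; unfold swapEntry; split_ifs <;> omega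
  obtain ⟨T', hT', hPT⟩ := (hP i hi (by omega) S).2.2
    ⟨r, c, r', c', h, h', s0, s1, by omega⟩ (by
      rintro ⟨x, y, x', y', hx, hx', f0, f1, ha⟩
      have := S.inj _ _ _ _ hx h (by omega)
      have := S.inj _ _ _ _ hx' h' (by omega)
      omega)
  have : T' = T := by
    apply SRCT.ext_entry
    rw [hT']
    funext x y
    unfold swapEntry
    rw [hS]
    unfold swapEntry
    split_ifs <;> omega
  rw [hPT, this]

theorem coeff_zero {α : List ℕ} (P : ℕ → Module.End ℂ (SRCT α →₀ ℂ)) (hP : PiChar α P)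
    (T : SRCT α) (i : ℕ) (h1 : 1 ≤ i) (h2 : i < α.sum) (hd : Descent α T i)
    (x : SRCT α →₀ ℂ) : (P i x) T = 0 := by
  classical
  have : (Finsupp.lapply T : (SRCT α →₀ ℂ) →ₗ[ℂ] ℂ) ∘ₗ (P i) = 0 := by
    apply Finsupp.lhom_ext'
    intro S
    apply LinearMap.ext_ring
    simp only [LinearMap.comp_apply, Finsupp.lsingle_apply, Finsupp.lapply_apply,
      LinearMap.zero_apply]
    by_cases hS : Descent α S i
    · by_cases hA : Attacking α S i
      · rw [(hP i h1 h2 S).2.1 hS hA]; rfl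
      · obtain ⟨S', hS', e⟩ := (hP i h1 h2 S).2.2 hS hA
        rw [e, Finsupp.single_apply, if_neg]
        rintro rfl
        obtain ⟨r, c, r', c', k1, k2, e1, e2, hc⟩ := hS
        obtain ⟨x, y, x', y', m1, m2, f1, f2, hy⟩ := hd
        have hne : c' ≠ c := fun hh => hA ⟨r, c, r', c', k1, k2, e1, e2, Or.inl hh⟩
        have g1 : S'.entry r c = i + 1 := by rw [hS']; unfold swapEntry; split_ifs <;> omega
        have g2 : S'.entry r' c' = i := by rw [hS']; unfold swapEntry; split_ifs <;> omega
        have := S'.inj _ _ _ _ m1 k2 (by omega)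
        have := S'.inj _ _ _ _ m2 k1 (by omega)
        omega
    · rw [(hP i h1 h2 S).1 hS, Finsupp.single_apply, if_neg]
      rintro rfl
      exact hS hd
  exact LinearMap.congr_fun this x

theorem idem_of_simple {α : List ℕ} (hpos : ∀ a ∈ α, 0 < a) (hs : SimpleComp α)
    (P : ℕ → Module.End ℂ (SRCT α →₀ ℂ)) (hP : PiChar α P)
    (f : Module.End ℂ (SRCT α →₀ ℂ)) (hf : f * f = f)
    (hc : ∀ i, 1 ≤ i → i < α.sum → f * P i = P i * f) : f = 0 ∨ f = 1 := by
  classical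
  have hcomm : ∀ i, 1 ≤ i → i < α.sum → ∀ x, f (P i x) = P i (f x) := fun i h1 h2 x =>
    LinearMap.congr_fun (hc i h1 h2) x
  set T0 := canon α hpos with hT0
  set a : ℂ := f (Finsupp.single T0 1) T0 with ha
  have h0 : f (Finsupp.single T0 1) = a • Finsupp.single T0 1 := by
    ext T
    by_cases hT : T = T0
    · subst hT; simp [ha]
    have hex : ∃ i, 1 ≤ i ∧ i < α.sum ∧ Descent α T i ∧ ¬ Descent α T0 i := by
      by_contra hno
      apply hT
      apply eq_canon
      apply bound_of_des hpos
      intro i h1 h2 h3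
      apply canon_des hpos
      by_contra h4
      exact hno ⟨i, h1, h2, h3, h4⟩
    obtain ⟨i, h1, h2, h3, h4⟩ := hex
    have h5 := hcomm i h1 h2 (Finsupp.single T0 1)
    rw [(hP i h1 h2 T0).1 h4] at h5
    rw [h5, coeff_zero P hP T i h1 h2 h3]
    simp [Finsupp.single_apply, Ne.symm hT]
  have hall : ∀ k T, (∑ p ∈ cells α, p.2 * α.sum) - pot α T = k →
      f (Finsupp.single T 1) = a • Finsupp.single T 1 := by
    intro k
    induction k using Nat.strong_induction_on with
    | _ k ih =>
      intro T hk
      by_cases hT : T = T0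
      · rw [hT]; exact h0
      obtain ⟨S, i, h1, h2, h3, h4⟩ := exists_pred hpos hs P hP T hT
      have hb := pot_le α S
      have h5 := ih _ (by omega) S rfl
      rw [← h4, hcomm i h2 h3, h5, map_smul]
  have hfa : f = a • 1 := by
    apply Finsupp.lhom_ext'
    intro T
    apply LinearMap.ext_ring
    simpa using hall _ T rfl
  have haa : a * a = a := by
    have h1 : f (f (Finsupp.single T0 1)) = f (Finsupp.single T0 1) :=
      LinearMap.congr_fun hf _
    rw [h0, map_smul, h0] at h1
    have h2 := DFunLike.congr_fun h1 T0
    simpa using h2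
  have : a = 0 ∨ a = 1 := by
    have : a * (a - 1) = 0 := by rw [mul_sub, haa]; ring
    rcases mul_eq_zero.1 this with h | h
    · exact Or.inl h
    · exact Or.inr (sub_eq_zero.1 h)
  rcases this with h | h
  · left; rw [hfa, h, zero_smul]
  · right; rw [hfa, h, one_smul]

theorem no_split_of_idem {V : Type*} [AddCommGroup V] [Module ℂ V] (n : ℕ)
    (P : ℕ → Module.End ℂ V)
    (H : ∀ f : Module.End ℂ V, f * f = f →
      (∀ i, 1 ≤ i → i < n → f * P i = P i * f) → f = 0 ∨ f = 1) :
    ¬ ∃ U W : Submodule ℂ V,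
        (∀ i, 1 ≤ i → i < n → Submodule.map (P i) U ≤ U) ∧
        (∀ i, 1 ≤ i → i < n → Submodule.map (P i) W ≤ W) ∧
        U ⊓ W = ⊥ ∧ U ⊔ W = ⊤ ∧ U ≠ ⊥ ∧ W ≠ ⊥ := by
  rintro ⟨U, W, hU, hW, hinf, hsup, hU0, hW0⟩
  have hcompl : IsCompl U W := ⟨disjoint_iff.2 hinf, codisjoint_iff.2 hsup⟩
  let f : Module.End ℂ V := U.projection W hcompl
  have fU : ∀ u ∈ U, f u = u := fun u hu =>
    Submodule.projection_apply_left hcompl ⟨u, hu⟩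
  have fW : ∀ w ∈ W, f w = 0 := fun w hw =>
    (Submodule.projection_apply_eq_zero_iff hcompl).2 hw
  have dec : ∀ x : V, ∃ u ∈ U, ∃ w ∈ W, u + w = x := fun x =>
    Submodule.mem_sup.1 (by rw [hsup]; trivial)
  have h := H f (by
      ext x
      obtain ⟨u, hu, w, hw, rfl⟩ := dec x
      simp [fU u hu, fW w hw]) (by
      intro i h1 h2
      ext x
      obtain ⟨u, hu, w, hw, rfl⟩ := dec x
      have g1 := fU _ (hU i h1 h2 (Submodule.mem_map_of_mem hu))
      have g2 := fW _ (hW i h1 h2 (Submodule.mem_map_of_mem hw))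
      simp [fU u hu, fW w hw, g1, g2])
  rcases h with h | h
  · apply hU0
    rw [Submodule.eq_bot_iff]
    intro u hu
    rw [← fU u hu, h]; rfl
  · apply hW0
    rw [Submodule.eq_bot_iff]
    intro w hw
    rw [← fW w hw, h]; rfl

/-- The cyclic shift of values used for the non-canonical tableau. -/
def cyc (q p m : ℕ) : ℕ := if m = p then q else if q ≤ m ∧ m < p then m + 1 else m

/-- In a complex composition there is a tableau with an inversion in a column. -/
theorem exists_inv {α : List ℕ} (hpos : ∀ a ∈ α, 0 < a) (i j : ℕ) (hij : i < j)
    (hj : j < α.length) (h2 : 2 ≤ α.getD j 0) (hle : α.getD j 0 ≤ α.getD i 0)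
    (hno : ∀ k, i < k → k < j → α.getD k 0 ≠ α.getD j 0 - 1) :
    ∃ T : SRCT α, T.entry j (α.getD j 0 - 1) < T.entry i (α.getD j 0 - 1) := by
  obtain ⟨b, hb⟩ : ∃ b, α.getD j 0 = b + 2 := ⟨α.getD j 0 - 2, by omega⟩
  obtain ⟨q, hq⟩ : ∃ q, q = psum α i + 1 := ⟨_, rfl⟩
  obtain ⟨p, hp⟩ : ∃ p, p = psum α j + 1 := ⟨_, rfl⟩
  have sj := psum_succ α j
  have si := psum_succ α i
  have mij := psum_mono α (show i + 1 ≤ j from hij)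
  have mjl := psum_mono α (show j + 1 ≤ α.length from hj)
  rw [psum_length] at mjl
  have cj : IsCell α j (b + 1) := ⟨hj, by omega⟩
  have ci : IsCell α i (b + 1) := ⟨by omega, by omega⟩
  have ecj := canon_entry α hpos _ _ cj
  have eci := canon_entry α hpos _ _ ci
  obtain ⟨C, hC⟩ : ∃ C, C = canon α hpos := ⟨_, rfl⟩
  have hCe : ∀ r c, IsCell α r c → C.entry r c + c = psum α (r + 1) := by
    rw [hC]; exact canon_entry α hpos
  rw [← hC] at ecj eci
  have posp : ∀ x y, IsCell α x y → C.entry x y = p → x = j ∧ y = b + 1 := fun x y hx he =>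
    C.inj _ _ _ _ hx cj (by omega)
  refine ⟨⟨fun r c => cyc q p (C.entry r c), ?_, ?_, ?_, ?_, ?_, ?_, ?_, ?_⟩, ?_⟩
  · intro x y hx
    have := C.zero_off x y hx
    unfold cyc; split_ifs <;> omega
  · intro x y hx
    have := C.one_le x y hx
    unfold cyc; split_ifs <;> omega
  · intro x y hx
    have := C.le_sum x y hx
    unfold cyc; split_ifs <;> omega
  · intro x y x' y' hx hx' he
    apply C.inj x y x' y' hx hx'
    unfold cyc at he; split_ifs at he <;> omega
  · intro m m1 m2
    obtain ⟨x, y, hx, hy⟩ := C.surj (if m = q then p else if q < m ∧ m ≤ p then m - 1 else m)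
      (by split_ifs <;> omega) (by split_ifs <;> omega)
    refine ⟨x, y, hx, ?_⟩
    rw [hy]
    unfold cyc; split_ifs <;> omega
  · intro x y hx
    have hx' : IsCell α x y := ⟨hx.1, by have := hx.2; omega⟩
    have h1 := C.row_dec x y hx
    have h3 := posp x y hx'
    have h4 := hx.2
    have h5 : C.entry x y ≠ p := by
      intro he
      obtain ⟨rfl, rfl⟩ := h3 he
      omega
    show cyc q p (C.entry x (y + 1)) < cyc q p (C.entry x y)
    unfold cyc; split_ifs <;> omega
  · intro x x' hlt hx hx'
    have h1 := C.col1_inc x x' hlt hx hx'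
    have h3 := posp x' 0 hx'
    show cyc q p (C.entry x 0) < cyc q p (C.entry x' 0)
    unfold cyc; split_ifs <;> omega
  · intro x x' y hlt hx hx' he
    change cyc q p (C.entry x' (y + 1)) < cyc q p (C.entry x y) at he
    show _ ∧ cyc q p (C.entry x' (y + 1)) < cyc q p (C.entry x (y + 1))
    have f1 := hCe x y hx
    have f2 := hCe x' (y + 1) hx'
    have m1 := psum_mono α (show x + 1 ≤ x' from hlt)
    have s1 := psum_succ α x'
    have l1 := hx'.2
    have hlt' : C.entry x y < C.entry x' (y + 1) := by omega
    have hpe : C.entry x' (y + 1) = p ∧ q ≤ C.entry x y := by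
      unfold cyc at he; split_ifs at he <;> omega
    obtain ⟨rfl, hy⟩ := posp _ _ hx' hpe.1
    have hyb : y = b := by omega
    subst hyb
    have hxi : i ≤ x := by
      by_contra hh
      have := psum_mono α (show x + 1 ≤ i by omega)
      omega
    have hcell : IsCell α x (y + 1) := by
      refine ⟨hx.1, ?_⟩
      have l2 := hx.2
      rcases Nat.eq_or_lt_of_le hxi with h | h
      · subst h; omega
      · have := hno x h hlt; omega
    refine ⟨hcell, ?_⟩
    have f3 := hCe x (y + 1) hcell
    have s2 := psum_succ α x
    have l3 := hcell.2
    have m2 := psum_mono α hxi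
    rw [hpe.1]
    unfold cyc; split_ifs <;> omega
  · have : α.getD j 0 - 1 = b + 1 := by omega
    rw [this]
    show cyc q p (C.entry j (b + 1)) < cyc q p (C.entry i (b + 1))
    unfold cyc; split_ifs <;> omega

theorem split_invariant {α : List ℕ} (P : ℕ → Module.End ℂ (SRCT α →₀ ℂ)) (hP : PiChar α P)
    (A : Set (SRCT α))
    (hA : ∀ S T : SRCT α, ∀ i, S ∈ A → ¬ Attacking α S i →
      T.entry = swapEntry α S i → T ∈ A)
    (i : ℕ) (h1 : 1 ≤ i) (h2 : i < α.sum) :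
    Submodule.map (P i) (Finsupp.supported ℂ ℂ A) ≤ Finsupp.supported ℂ ℂ A := by
  rw [Finsupp.supported_eq_span_single, Submodule.map_span_le]
  rintro _ ⟨S, hS, rfl⟩
  by_cases hd : Descent α S i
  · by_cases ha : Attacking α S i
    · simp only [(hP i h1 h2 S).2.1 hd ha]; exact Submodule.zero_mem _
    · obtain ⟨T, hT, e⟩ := (hP i h1 h2 S).2.2 hd ha
      simp only [e]
      exact Submodule.subset_span ⟨T, hA S T i hS ha hT, rfl⟩
  · simp only [(hP i h1 h2 S).1 hd]
    exact Submodule.subset_span ⟨S, hS, rfl⟩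

theorem swap_lt_iff {α : List ℕ} (S T : SRCT α) (m c i j : ℕ) (hi : IsCell α i c)
    (hj : IsCell α j c) (hn : ¬ Attacking α S m) (hT : T.entry = swapEntry α S m) :
    T.entry i c < T.entry j c ↔ S.entry i c < S.entry j c := by
  have a1 : ¬ (S.entry i c = m ∧ S.entry j c = m + 1) := fun h =>
    hn ⟨i, c, j, c, hi, hj, h.1, h.2, Or.inl rfl⟩
  have a2 : ¬ (S.entry j c = m ∧ S.entry i c = m + 1) := fun h =>
    hn ⟨j, c, i, c, hj, hi, h.1, h.2, Or.inl rfl⟩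
  rw [hT]
  unfold swapEntry
  split_ifs <;> omega

theorem simple_of_no_split {α : List ℕ} (hpos : ∀ a ∈ α, 0 < a)
    (P : ℕ → Module.End ℂ (SRCT α →₀ ℂ)) (hP : PiChar α P)
    (H : ¬ ∃ U W : Submodule ℂ (SRCT α →₀ ℂ),
        (∀ i, 1 ≤ i → i < α.sum → Submodule.map (P i) U ≤ U) ∧
        (∀ i, 1 ≤ i → i < α.sum → Submodule.map (P i) W ≤ W) ∧
        U ⊓ W = ⊥ ∧ U ⊔ W = ⊤ ∧ U ≠ ⊥ ∧ W ≠ ⊥) : SimpleComp α := by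
  intro i j hij hj h2 hle
  by_contra hno
  push Not at hno
  obtain ⟨T, hT⟩ := exists_inv hpos i j hij hj h2 hle hno
  set c := α.getD j 0 - 1 with hc
  have ci : IsCell α i c := ⟨by omega, by omega⟩
  have cj : IsCell α j c := ⟨by omega, by omega⟩
  let A : Set (SRCT α) := {S | S.entry i c < S.entry j c}
  have hTA : T ∈ Aᶜ := by
    show ¬ (T.entry i c < T.entry j c)
    omega
  have hCA : canon α hpos ∈ A := by
    show (canon α hpos).entry i c < (canon α hpos).entry j c
    have e1 := canon_entry α hpos i c ci
    have e2 := canon_entry α hpos j c cj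
    have e3 := psum_mono α (show i + 1 ≤ j from hij)
    have e4 := psum_succ α j
    omega
  have nz : ∀ (B : Set (SRCT α)) (S : SRCT α), S ∈ B → Finsupp.supported ℂ ℂ B ≠ ⊥ := by
    intro B S hS hbot
    have h1 : Finsupp.single S (1 : ℂ) ∈ Finsupp.supported ℂ ℂ B :=
      Finsupp.single_mem_supported ℂ 1 hS
    rw [hbot, Submodule.mem_bot] at h1
    simp at h1
  refine H ⟨Finsupp.supported ℂ ℂ A, Finsupp.supported ℂ ℂ Aᶜ, ?_, ?_, ?_, ?_,
    nz _ _ hCA, nz _ _ hTA⟩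
  · apply split_invariant P hP
    intro S T m hS hn e
    exact (swap_lt_iff S T m c i j ci cj hn e).2 hS
  · apply split_invariant P hP
    intro S T m hS hn e hTm
    exact hS ((swap_lt_iff S T m c i j ci cj hn e).1 hTm)
  · rw [← Finsupp.supported_inter, Set.inter_compl_self, Finsupp.supported_empty]
  · rw [← Finsupp.supported_union, Set.union_compl_self, Finsupp.supported_univ]

/-- `S_α` is an indecomposable `H_n(0)`-module iff `α` is simple; equivalently, every
idempotent linear endomorphism commuting with all the operators `π_i` is `0` or the identity,
iff `α` is simple. -/
theorem indecomposable_iff_simple (n : ℕ) (hn : 1 ≤ n) (α : List ℕ)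
    (hpos : ∀ a ∈ α, 0 < a) (hsum : α.sum = n)
    (P : ℕ → Module.End ℂ (SRCT α →₀ ℂ)) (hP : PiChar α P) :
    ((¬ ∃ U W : Submodule ℂ (SRCT α →₀ ℂ),
        (∀ i, 1 ≤ i → i < n → Submodule.map (P i) U ≤ U) ∧
        (∀ i, 1 ≤ i → i < n → Submodule.map (P i) W ≤ W) ∧
        U ⊓ W = ⊥ ∧ U ⊔ W = ⊤ ∧ U ≠ ⊥ ∧ W ≠ ⊥) ↔ SimpleComp α) ∧
    ((∀ f : Module.End ℂ (SRCT α →₀ ℂ), f * f = f →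
        (∀ i, 1 ≤ i → i < n → f * P i = P i * f) → f = 0 ∨ f = 1) ↔ SimpleComp α) := by
  subst hsum
  have h12 := fun hs f => idem_of_simple hpos hs P hP f
  have h23 := no_split_of_idem α.sum P
  have h31 := simple_of_no_split hpos P hP
  exact ⟨⟨h31, fun hs => h23 (h12 hs)⟩, ⟨fun h => h31 (h23 h), h12⟩⟩
end
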